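/- Let d ≥ 1, let C ⊆ ℝ^{d+1} be a nonempty open convex cone containing no affine line, let Ω ⊆ ℝP^d be its projectivization, and let Γ be a discrete subgroup of SL^±_{d+1}(ℝ) preserving C whose projective action on Ω is cocompact (Ω/Γ is compact). Then the following conditions are equivalent: (i) the virtual center of Γ is trivial; (ii) every finite-index subgroup of Γ has finite center; (iii) every finite-index subgroup of Γ acts irreducibly on ℝ^{d+1} (preserves no linear subspace other than {0} and ℝ^{d+1}); (iv) Γ contains no infinite nilpotent normal subgroup; (v) Γ contains no infinite abelian normal subgroup. -/

import Mathlib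

open Matrix

noncomputable section

/-- `ℝ^{d+1}`. -/
abbrev Vec (d : ℕ) := Fin (d + 1) → ℝ

/-- The real projective space `ℝP^d`. -/
abbrev RP (d : ℕ) := Projectivization ℝ (Vec d)

instance (d : ℕ) : TopologicalSpace (RP d) :=
  inferInstanceAs (TopologicalSpace (Quotient (projectivizationSetoid ℝ (Vec d))))

/-- The projective transformation of `ℝP^d` induced by an invertible matrix. -/
def projMap {d : ℕ} (g : GL (Fin (d + 1)) ℝ) : RP d → RP d :=
  Projectivization.map (Matrix.mulVecLin (g : Matrix (Fin (d + 1)) (Fin (d + 1)) ℝ))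
    (by
      intro x y hxy
      have hdet : IsUnit (g : Matrix (Fin (d + 1)) (Fin (d + 1)) ℝ).det :=
        (Matrix.isUnit_iff_isUnit_det _).mp g.isUnit
      have h := congrArg
        (Matrix.mulVec ((g : Matrix (Fin (d + 1)) (Fin (d + 1)) ℝ))⁻¹) hxy
      simpa [Matrix.mulVecLin_apply, Matrix.mulVec_mulVec,
        Matrix.nonsing_inv_mul _ hdet] using h)

/-- A sharp convex open cone in `ℝ^{d+1}`: nonempty, open, convex, stable under positive
scalars, containing no affine line. -/
def IsProperCone {d : ℕ} (C : Set (Vec d)) : Prop :=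
  C.Nonempty ∧ IsOpen C ∧ Convex ℝ C ∧
    (∀ x ∈ C, ∀ t : ℝ, 0 < t → t • x ∈ C) ∧
    ¬ ∃ x v : Vec d, v ≠ 0 ∧ ∀ t : ℝ, x + t • v ∈ C

/-- The projectivization of a cone: a subset of `ℝP^d`. -/
def projOfCone {d : ℕ} (C : Set (Vec d)) : Set (RP d) :=
  {P | ∃ (v : Vec d) (hv : v ≠ 0), v ∈ C ∧ P = Projectivization.mk ℝ v hv}

/-- `Ω` is a properly convex domain if it is the projectivization of a sharp convex open
cone. -/
def IsProperlyConvexDomain {d : ℕ} (Ω : Set (RP d)) : Prop :=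
  ∃ C : Set (Vec d), IsProperCone C ∧ Ω = projOfCone C

/-- Membership in `SL^±_{d+1}(ℝ)`: determinant `±1`. -/
def detPM1 {d : ℕ} (g : GL (Fin (d + 1)) ℝ) : Prop :=
  (g : Matrix (Fin (d + 1)) (Fin (d + 1)) ℝ).det = 1 ∨
  (g : Matrix (Fin (d + 1)) (Fin (d + 1)) ℝ).det = -1

/-- `Γ` preserves `Ω` (projectively). -/
def PreservesDomain {d : ℕ} (Γ : Subgroup (GL (Fin (d + 1)) ℝ)) (Ω : Set (RP d)) : Prop :=
  ∀ γ ∈ Γ, projMap γ '' Ω = Ω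

/-- The action of `Γ` on `Ω` is properly discontinuous. -/
def ProperlyDiscontinuousOn {d : ℕ} (Γ : Subgroup (GL (Fin (d + 1)) ℝ))
    (Ω : Set (RP d)) : Prop :=
  ∀ K : Set (RP d), K ⊆ Ω → IsCompact K →
    {γ : Γ | (projMap (γ : GL (Fin (d + 1)) ℝ) '' K ∩ K).Nonempty}.Finite

/-- The action of `Γ` on `Ω` is cocompact: `Ω/Γ` is compact. -/
def CocompactOn {d : ℕ} (Γ : Subgroup (GL (Fin (d + 1)) ℝ)) (Ω : Set (RP d)) : Prop :=
  ∃ K : Set (RP d), IsCompact K ∧ K ⊆ Ω ∧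
    (⋃ γ ∈ Γ, projMap γ '' K) = Ω

/-- `Ω` is divided by `Γ`: `Γ` consists of determinant-`±1` matrices, is discrete,
preserves `Ω`, and acts properly discontinuously and cocompactly on `Ω`. -/
def Divides {d : ℕ} (Γ : Subgroup (GL (Fin (d + 1)) ℝ)) (Ω : Set (RP d)) : Prop :=
  (∀ γ ∈ Γ, detPM1 γ) ∧ DiscreteTopology Γ ∧ PreservesDomain Γ Ω ∧
    ProperlyDiscontinuousOn Γ Ω ∧ CocompactOn Γ Ω

/-- `Ω` is strictly convex: its boundary contains no nondegenerate projective line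
segment. -/
def IsStrictlyConvexDomain {d : ℕ} (Ω : Set (RP d)) : Prop :=
  ∀ v w : Vec d, LinearIndependent ℝ ![v, w] →
    ¬ ∀ t ∈ Set.Icc (0 : ℝ) 1, ∀ h : t • v + (1 - t) • w ≠ 0,
        Projectivization.mk ℝ (t • v + (1 - t) • w) h ∈ frontier Ω

/-- Every finite-index subgroup of `Γ` acts irreducibly on `ℝ^{d+1}`. -/
def StronglyIrreducible {d : ℕ} (Γ : Subgroup (GL (Fin (d + 1)) ℝ)) : Prop :=
  ∀ Δ : Subgroup (GL (Fin (d + 1)) ℝ), Δ ≤ Γ → (Δ.subgroupOf Γ).FiniteIndex →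
    ∀ W : Submodule ℝ (Vec d),
      (∀ γ ∈ Δ, ∀ x ∈ W,
        Matrix.mulVec ((γ : GL (Fin (d + 1)) ℝ) : Matrix (Fin (d + 1)) (Fin (d + 1)) ℝ) x ∈ W) →
      W = ⊥ ∨ W = ⊤

/-- The `k`-simplex spanned by `v : Fin (k+1) → ℝ^{d+1}` in `ℝP^d`. -/
def simplexSet {d k : ℕ} (v : Fin (k + 1) → Vec d) : Set (RP d) :=
  {P | ∃ t : Fin (k + 1) → ℝ, (∀ i, 0 ≤ t i) ∧ t ≠ 0 ∧
    ∃ h : (∑ i, t i • v i) ≠ 0, P = Projectivization.mk ℝ (∑ i, t i • v i) h}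

/-- The relative interior of the `k`-simplex spanned by `v`. -/
def simplexInterior {d k : ℕ} (v : Fin (k + 1) → Vec d) : Set (RP d) :=
  {P | ∃ t : Fin (k + 1) → ℝ, (∀ i, 0 < t i) ∧
    ∃ h : (∑ i, t i • v i) ≠ 0, P = Projectivization.mk ℝ (∑ i, t i • v i) h}

/-- A properly embedded `k`-simplex in `Ω`: relative interior inside `Ω` and boundary
inside `∂Ω`. -/
def ProperlyEmbeddedSimplex {d k : ℕ} (Ω : Set (RP d)) (v : Fin (k + 1) → Vec d) : Prop :=
  LinearIndependent ℝ v ∧ simplexInterior v ⊆ Ω ∧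
    simplexSet v \ simplexInterior v ⊆ frontier Ω

/-- `φ` cuts out a supporting hyperplane of `Ω` at `x`. -/
def IsSupportingAt {d : ℕ} (Ω : Set (RP d)) (φ : Module.Dual ℝ (Vec d)) (x : RP d) : Prop :=
  φ ≠ 0 ∧ φ x.rep = 0 ∧ ∀ P ∈ Ω, φ (Projectivization.rep P) ≠ 0

end

section ClosedCones

variable {E : Type*} [NormedAddCommGroup E] [NormedSpace ℝ E]

/-- A closed convex cone containing the origin. -/
structure IsClosedCone (P : Set E) : Prop where
  isClosed : IsClosed P
  zero_mem : (0 : E) ∈ P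
  add_mem : ∀ {x y : E}, x ∈ P → y ∈ P → x + y ∈ P
  smul_mem : ∀ {t : ℝ} {x : E}, 0 ≤ t → x ∈ P → t • x ∈ P

theorem Submodule.isClosedCone [FiniteDimensional ℝ E] (W : Submodule ℝ E) :
    IsClosedCone (W : Set E) where
  isClosed := W.closed_of_finiteDimensional
  zero_mem := W.zero_mem
  add_mem := W.add_mem
  smul_mem _ hx := W.smul_mem _ hx

theorem IsClosedCone.inter {P Q : Set E} (hP : IsClosedCone P) (hQ : IsClosedCone Q) :
    IsClosedCone (P ∩ Q) where
  isClosed := hP.isClosed.inter hQ.isClosed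
  zero_mem := ⟨hP.zero_mem, hQ.zero_mem⟩
  add_mem hx hy := ⟨hP.add_mem hx.1 hy.1, hQ.add_mem hx.2 hy.2⟩
  smul_mem ht hx := ⟨hP.smul_mem ht hx.1, hQ.smul_mem ht hx.2⟩

theorem IsClosedCone.sum_mem {P : Set E} (hP : IsClosedCone P) {ι : Type*} (s : Finset ι)
    (f : ι → E) (h : ∀ i ∈ s, f i ∈ P) : ∑ i ∈ s, f i ∈ P := by
  classical
  induction s using Finset.induction_on with
  | empty => simpa using hP.zero_mem
  | insert a s ha ih =>
    rw [Finset.sum_insert ha]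
    exact hP.add_mem (h a (by simp)) (ih fun i hi => h i (by simp [hi]))

/-- Two transverse closed cones are uniformly transverse. -/
theorem IsClosedCone.exists_norm_le_norm_add [FiniteDimensional ℝ E] {P Q : Set E}
    (hP : IsClosedCone P) (hQ : IsClosedCone Q) (hPQ : ∀ x ∈ P, -x ∈ Q → x = 0) :
    ∃ c > 0, ∀ p ∈ P, ∀ q ∈ Q, ‖p‖ ≤ c * ‖p + q‖ := by
  have : ProperSpace E := FiniteDimensional.proper ℝ E
  have hS : IsCompact (P ∩ Metric.sphere 0 1) := (isCompact_sphere 0 1).inter_left hP.isClosed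
  have hQn : (-Q).Nonempty := ⟨0, by simpa using hQ.zero_mem⟩
  obtain ⟨ε, hε, h⟩ := hS.exists_forall_le' (f := fun p => Metric.infDist p (-Q))
    (Metric.continuous_infDist_pt _).continuousOn (a := 0) (by
      rintro p ⟨hp, hp1⟩
      refine (hQ.isClosed.neg.notMem_iff_infDist_pos hQn).1 fun hmem => ?_
      have := hPQ p hp hmem
      simp [this] at hp1)
  refine ⟨ε⁻¹, inv_pos.2 hε, fun p hp q hq => ?_⟩
  rcases eq_or_ne p 0 with rfl | hp0
  · simp only [norm_zero]
    positivity
  have hn : 0 < ‖p‖ := norm_pos_iff.2 hp0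
  have h1 : ε ≤ Metric.infDist (‖p‖⁻¹ • p) (-Q) :=
    h _ ⟨hP.smul_mem (by positivity) hp, by simp [norm_smul, hn.ne']⟩
  have h2 : Metric.infDist (‖p‖⁻¹ • p) (-Q) ≤ dist (‖p‖⁻¹ • p) (-(‖p‖⁻¹ • q)) :=
    Metric.infDist_le_dist_of_mem (by simpa using hQ.smul_mem (by positivity) hq)
  have h3 : dist (‖p‖⁻¹ • p) (-(‖p‖⁻¹ • q)) = ‖p‖⁻¹ * ‖p + q‖ := by
    rw [dist_eq_norm, sub_neg_eq_add, ← smul_add, norm_smul, norm_inv, norm_norm]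
  have h4 : ε ≤ ‖p‖⁻¹ * ‖p + q‖ := by linarith
  calc ‖p‖ = ε⁻¹ * (ε * ‖p‖) := by field_simp
    _ ≤ ε⁻¹ * ((‖p‖⁻¹ * ‖p + q‖) * ‖p‖) := by gcongr
    _ = ε⁻¹ * ‖p + q‖ := by field_simp

/-- A closed cone has a point in its relative interior. -/
theorem IsClosedCone.exists_relInterior [FiniteDimensional ℝ E] {F : Set E}
    (hF : IsClosedCone F) :
    ∃ f₀ ∈ F, ∃ δ > 0, ∀ v ∈ Submodule.span ℝ F, ‖v‖ ≤ δ → f₀ + v ∈ F := by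
  classical
  obtain ⟨b, hbF, hspan, hli⟩ := exists_linearIndependent ℝ F
  have : Finite b := hli.finite
  have := Fintype.ofFinite b
  let B : Module.Basis b ℝ (Submodule.span ℝ (Set.range ((↑) : b → E))) := Module.Basis.span hli
  let T := LinearMap.toContinuousLinearMap B.equivFun.toLinearMap
  have hrange : Submodule.span ℝ (Set.range ((↑) : b → E)) = Submodule.span ℝ F := by
    rw [Subtype.range_coe, hspan]
  refine ⟨∑ i : b, (i : E), hF.sum_mem _ _ fun i _ => hbF i.2, (‖T‖ + 1)⁻¹, by positivity,
    fun v hv hvn => ?_⟩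
  rw [← hrange] at hv
  have hc : ∀ i, ‖B.equivFun ⟨v, hv⟩ i‖ ≤ 1 := fun i => by
    calc ‖B.equivFun ⟨v, hv⟩ i‖ ≤ ‖T ⟨v, hv⟩‖ := norm_le_pi_norm (T ⟨v, hv⟩) i
      _ ≤ ‖T‖ * ‖v‖ := T.le_opNorm ⟨v, hv⟩
      _ ≤ ‖T‖ * (‖T‖ + 1)⁻¹ := by gcongr
      _ ≤ 1 := by
        rw [mul_inv_le_iff₀ (by positivity)]
        linarith
  have hsum : v = ∑ i : b, B.equivFun ⟨v, hv⟩ i • (i : E) := by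
    have := congrArg Subtype.val (B.sum_equivFun ⟨v, hv⟩)
    simp only [Submodule.coe_sum, Submodule.coe_smul] at this
    refine this.symm.trans (Finset.sum_congr rfl fun i _ => ?_)
    rw [Module.Basis.span_apply]
  have : ∑ i : b, (i : E) + v = ∑ i : b, (1 + B.equivFun ⟨v, hv⟩ i) • (i : E) := by
    conv_lhs => rw [hsum]
    rw [← Finset.sum_add_distrib]
    simp [add_smul]
  rw [this]
  refine hF.sum_mem _ _ fun i _ => hF.smul_mem ?_ (hbF i.2)
  have := (abs_le.1 (hc i)).1
  linarith

/-- A point of the relative interior of a closed cone dominates every point of the cone. -/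
theorem IsClosedCone.smul_sub_mem_of_relInterior {F : Set E} (hF : IsClosedCone F) {f₀ : E}
    {δ : ℝ} (hδ : 0 < δ)
    (h : ∀ v ∈ Submodule.span ℝ F, ‖v‖ ≤ δ → f₀ + v ∈ F) {f : E}
    (hf : f ∈ Submodule.span ℝ F) : (‖f‖ / δ) • f₀ - f ∈ F := by
  rcases eq_or_ne f 0 with rfl | hf0
  · simpa using hF.zero_mem
  have hn : 0 < ‖f‖ := norm_pos_iff.2 hf0
  have h1 : f₀ + (-(δ / ‖f‖)) • f ∈ F := h _ (Submodule.smul_mem _ _ hf) (by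
    rw [norm_smul, norm_neg, Real.norm_of_nonneg (by positivity), div_mul_cancel₀ _ hn.ne'])
  have h2 := hF.smul_mem (t := ‖f‖ / δ) (by positivity) h1
  rwa [smul_add, smul_smul, show ‖f‖ / δ * -(δ / ‖f‖) = -1 by field_simp, neg_one_smul,
    ← sub_eq_add_neg] at h2

/-- Every vector of the span of a closed cone is a difference of two vectors of the cone of
comparable size. -/
theorem IsClosedCone.exists_sub_of_mem_span [FiniteDimensional ℝ E] {F : Set E}
    (hF : IsClosedCone F) :
    ∃ c > 0, ∀ v ∈ Submodule.span ℝ F, ∃ a ∈ F, ∃ b ∈ F, v = a - b ∧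
      ‖a‖ ≤ c * ‖v‖ ∧ ‖b‖ ≤ c * ‖v‖ := by
  obtain ⟨f₀, hf₀, δ, hδ, h⟩ := hF.exists_relInterior
  refine ⟨‖f₀‖ / δ + 1, by positivity, fun v hv => ?_⟩
  have h1 := hF.smul_sub_mem_of_relInterior hδ h (Submodule.neg_mem _ hv)
  rw [norm_neg, sub_neg_eq_add] at h1
  have h2 : ‖(‖v‖ / δ) • f₀‖ = ‖f₀‖ / δ * ‖v‖ := by
    rw [norm_smul, Real.norm_of_nonneg (by positivity)]
    ring
  refine ⟨_, h1, (‖v‖ / δ) • f₀, hF.smul_mem (by positivity) hf₀, by abel, ?_, ?_⟩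
  · refine (norm_add_le _ _).trans ?_
    rw [h2]
    linarith
  · rw [h2]
    nlinarith [norm_nonneg v]

/-- A linear map controlled on a closed cone is controlled on its span. -/
theorem IsClosedCone.exists_bound_on_span [FiniteDimensional ℝ E] {F : Set E}
    (hF : IsClosedCone F) :
    ∃ c > 0, ∀ (T : E →ₗ[ℝ] E) (m : ℝ), 0 ≤ m → (∀ f ∈ F, ‖T f‖ ≤ m * ‖f‖) →
      ∀ v ∈ Submodule.span ℝ F, ‖T v‖ ≤ c * m * ‖v‖ := by
  obtain ⟨c, hc, h⟩ := hF.exists_sub_of_mem_span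
  refine ⟨2 * c, by positivity, fun T m hm hT v hv => ?_⟩
  obtain ⟨a, ha, b, hb, hv', han, hbn⟩ := h v hv
  calc ‖T v‖ = ‖T a - T b‖ := by rw [hv', map_sub]
    _ ≤ ‖T a‖ + ‖T b‖ := norm_sub_le _ _
    _ ≤ m * (c * ‖v‖) + m * (c * ‖v‖) := by
      gcongr
      · exact (hT a ha).trans (by gcongr)
      · exact (hT b hb).trans (by gcongr)
    _ = 2 * c * m * ‖v‖ := by ring

end ClosedCones

section ConeActions

variable {E : Type*} [NormedAddCommGroup E] [NormedSpace ℝ E] {G : Type*} [Group G]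

/-- The group `G` acts linearly on the sharp open convex cone `C`, and the translates of the
compact set `K` cover `C` up to homotheties. -/
structure IsCocompactConeAction (ρ : G →* (E →L[ℝ] E)) (C K : Set E) : Prop where
  isOpen : IsOpen C
  nonempty : C.Nonempty
  add_mem : ∀ {x y : E}, x ∈ C → y ∈ C → x + y ∈ C
  smul_mem : ∀ {t : ℝ} {x : E}, 0 < t → x ∈ C → t • x ∈ C
  zero_notMem : (0 : E) ∉ C
  salient : ∀ x ∈ closure C, -x ∈ closure C → x = 0
  map_mem : ∀ (g : G) {x : E}, x ∈ C → ρ g x ∈ C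
  isCompact : IsCompact K
  subset : K ⊆ C
  cover : ∀ x ∈ C, ∃ g : G, ∃ τ : ℝ, 0 < τ ∧ ∃ k ∈ K, x = τ • ρ g k

theorem MonoidHom.clm_inv_apply (ρ : G →* (E →L[ℝ] E)) (g : G) (x : E) :
    ρ g⁻¹ (ρ g x) = x := by
  rw [← mul_apply_eq_comp, ← map_mul, inv_mul_cancel, map_one,
    one_apply_eq_self]

theorem MonoidHom.clm_apply_inv (ρ : G →* (E →L[ℝ] E)) (g : G) (x : E) :
    ρ g (ρ g⁻¹ x) = x := by
  simpa using ρ.clm_inv_apply g⁻¹ x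

namespace IsCocompactConeAction

variable {ρ : G →* (E →L[ℝ] E)} {C K : Set E}

theorem isClosedCone (h : IsCocompactConeAction ρ C K) : IsClosedCone (closure C) where
  isClosed := isClosed_closure
  zero_mem := by
    obtain ⟨x, hx⟩ := h.nonempty
    have h1 : Filter.Tendsto (fun t : ℝ => t • x) (nhdsWithin 0 (Set.Ioi 0)) (nhds 0) := by
      have : Filter.Tendsto (fun t : ℝ => t • x) (nhds 0) (nhds ((0 : ℝ) • x)) :=
        (continuous_id.smul continuous_const).tendsto 0
      rw [zero_smul] at this
      exact this.mono_left nhdsWithin_le_nhds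
    exact mem_closure_of_tendsto h1
      (Filter.mem_of_superset self_mem_nhdsWithin fun t ht => h.smul_mem ht hx)
  add_mem hx hy := map_mem_closure₂ continuous_add hx hy fun _ ha _ hb => h.add_mem ha hb
  smul_mem {t x} ht hx := by
    rcases ht.eq_or_lt with rfl | ht
    · obtain ⟨y, hy⟩ := h.nonempty
      rw [zero_smul]
      have h1 : Filter.Tendsto (fun t : ℝ => t • y) (nhdsWithin 0 (Set.Ioi 0)) (nhds 0) := by
        have : Filter.Tendsto (fun t : ℝ => t • y) (nhds 0) (nhds ((0 : ℝ) • y)) :=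
          (continuous_id.smul continuous_const).tendsto 0
        rw [zero_smul] at this
        exact this.mono_left nhdsWithin_le_nhds
      exact mem_closure_of_tendsto h1
        (Filter.mem_of_superset self_mem_nhdsWithin fun t ht => h.smul_mem ht hy)
    · exact map_mem_closure (continuous_const_smul t) hx fun _ ha => h.smul_mem ht ha

theorem add_mem_of_mem_closure (h : IsCocompactConeAction ρ C K) {x y : E}
    (hx : x ∈ closure C) (hy : y ∈ C) : x + y ∈ C := by
  have h1 : Filter.Tendsto (fun z => y + (x - z)) (nhds x) (nhds y) := by
    have : Continuous fun z => y + (x - z) := by fun_prop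
    simpa using this.tendsto x
  obtain ⟨z, hz, hzC⟩ := mem_closure_iff_nhds.1 hx _ (h1 (h.isOpen.mem_nhds hy))
  have := h.add_mem hzC hz
  rwa [show z + (y + (x - z)) = x + y by abel] at this

theorem map_mem_closure (h : IsCocompactConeAction ρ C K) (g : G) {x : E}
    (hx : x ∈ closure C) : ρ g x ∈ closure C :=
  _root_.map_mem_closure (ρ g).continuous hx fun _ ha => h.map_mem g ha

theorem exists_ball (h : IsCocompactConeAction ρ C K) :
    ∃ δ > 0, ∀ k ∈ K, ∀ v : E, ‖v‖ ≤ δ → k + v ∈ C := by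
  obtain ⟨δ, hδ, hK⟩ := h.isCompact.exists_cthickening_subset_open h.isOpen h.subset
  refine ⟨δ, hδ, fun k hk v hv => hK ?_⟩
  refine Metric.mem_cthickening_of_dist_le _ k _ _ hk ?_
  simpa [dist_eq_norm] using hv

theorem exists_smul_sub_mem (h : IsCocompactConeAction ρ C K) :
    ∃ δ > 0, ∀ k ∈ K, ∀ v : E, (‖v‖ / δ) • k - v ∈ closure C := by
  obtain ⟨δ, hδ, hK⟩ := h.exists_ball
  refine ⟨δ, hδ, fun k hk v => ?_⟩
  rcases eq_or_ne v 0 with rfl | hv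
  · simpa using h.isClosedCone.zero_mem
  have hn : 0 < ‖v‖ := norm_pos_iff.2 hv
  have h1 : k + (-(δ / ‖v‖)) • v ∈ C := hK k hk _ (by
    rw [norm_smul, norm_neg, Real.norm_of_nonneg (by positivity), div_mul_cancel₀ _ hn.ne'])
  have h2 := h.smul_mem (t := ‖v‖ / δ) (by positivity) h1
  rw [smul_add, smul_smul, show ‖v‖ / δ * -(δ / ‖v‖) = -1 by field_simp, neg_one_smul,
    ← sub_eq_add_neg] at h2
  exact subset_closure h2

variable [FiniteDimensional ℝ E]

theorem exists_norm_le (h : IsCocompactConeAction ρ C K) :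
    ∃ c > 0, ∀ v ∈ closure C, ∀ a : E, a - v ∈ closure C → ‖v‖ ≤ c * ‖a‖ := by
  obtain ⟨c, hc, hn⟩ := h.isClosedCone.exists_norm_le_norm_add h.isClosedCone h.salient
  exact ⟨c, hc, fun v hv a ha => by simpa using hn v hv _ ha⟩

theorem exists_norm_le_of_abs (h : IsCocompactConeAction ρ C K) :
    ∃ c > 0, ∀ v a : E, a - v ∈ closure C → a + v ∈ closure C → ‖v‖ ≤ c * ‖a‖ := by
  obtain ⟨c, hc, hn⟩ := h.exists_norm_le
  refine ⟨2 * c + 1, by positivity, fun v a h1 h2 => ?_⟩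
  have h3 := hn (a + v) h2 ((2 : ℝ) • a) (by
    rwa [two_smul, show a + a - (a + v) = a - v by abel])
  rw [norm_smul, Real.norm_two] at h3
  have h4 : ‖v‖ ≤ ‖a + v‖ + ‖a‖ := by
    simpa using norm_sub_le (a + v) a
  linarith

/-- An invariant subspace that meets the open cone is the whole space. -/
theorem eq_top_of_mem (h : IsCocompactConeAction ρ C K) (W : Submodule ℝ E)
    (hW : ∀ g, ∀ x ∈ W, ρ g x ∈ W) {w₀ : E} (hw₀ : w₀ ∈ W) (hw₀C : w₀ ∈ C) : W = ⊤ := by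
  obtain ⟨δ, hδ, hK⟩ := h.exists_ball
  obtain ⟨c, hc, hn⟩ := h.exists_norm_le
  obtain ⟨δ₀, hδ₀, hball⟩ : ∃ δ₀ > 0, ∀ v : E, ‖v‖ ≤ δ₀ → w₀ + v ∈ C := by
    obtain ⟨δ₀, hδ₀, hb⟩ := Metric.nhds_basis_closedBall.mem_iff.1 (h.isOpen.mem_nhds hw₀C)
    exact ⟨δ₀, hδ₀, fun v hv => hb (by simpa [dist_eq_norm] using hv)⟩
  obtain ⟨R, hR⟩ := h.isCompact.isBounded.exists_norm_le
  -- every point of `C` dominates a definite proportion of itself lying in `W`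
  obtain ⟨θ, hθ0, hθ1, hstep⟩ : ∃ θ : ℝ, 0 ≤ θ ∧ θ < 1 ∧ ∀ x ∈ C, ∃ w ∈ W, x - w ∈ C ∧
      θ • x - (x - w) ∈ closure C := by
    set ε := δ / (‖w₀‖ + 1) with hε
    have hεpos : 0 < ε := by positivity
    set η := min (1 / 2) (ε * δ₀ / (|R| + 1)) with hη
    have hηpos : 0 < η := by positivity
    have hη1 : η ≤ 1 / 2 := min_le_left _ _
    refine ⟨1 - η, by linarith, by linarith, fun x hx => ?_⟩
    obtain ⟨g, τ, hτ, k, hk, rfl⟩ := h.cover x hx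
    refine ⟨τ • ρ g (ε • w₀), W.smul_mem _ (hW g _ (W.smul_mem _ hw₀)), ?_, ?_⟩
    · rw [← smul_sub, ← map_sub, sub_eq_add_neg]
      refine h.smul_mem hτ (h.map_mem g (hK k hk _ ?_))
      rw [norm_neg, norm_smul, Real.norm_of_nonneg hεpos.le, hε, div_mul_eq_mul_div,
        div_le_iff₀ (by positivity)]
      gcongr
      linarith
    · have h1 : ε • w₀ - η • k ∈ C := by
        have h2 : w₀ + (-(η / ε)) • k ∈ C := hball _ (by
          rw [norm_smul, norm_neg, Real.norm_of_nonneg (by positivity)]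
          have h3 : ‖k‖ ≤ |R| + 1 := (hR k hk).trans (by linarith [le_abs_self R])
          calc η / ε * ‖k‖ ≤ (ε * δ₀ / (|R| + 1)) / ε * (|R| + 1) := by
                gcongr
                exact min_le_right _ _
            _ = δ₀ := by field_simp)
        have h3 := h.smul_mem hεpos h2
        rwa [smul_add, smul_smul, show ε * -(η / ε) = -η by field_simp, neg_smul,
          ← sub_eq_add_neg] at h3
      have h4 := h.smul_mem hτ (h.map_mem g h1)
      refine subset_closure ?_
      convert h4 using 1
      simp only [map_sub, map_smul]
      module
  have hiter : ∀ x ∈ C, ∀ n : ℕ, ∃ y ∈ C, x - y ∈ W ∧ θ ^ n • x - y ∈ closure C := by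
    intro x hx n
    induction n with
    | zero => exact ⟨x, hx, by simp, by simpa using h.isClosedCone.zero_mem⟩
    | succ n ih =>
      obtain ⟨y, hy, hxy, hle⟩ := ih
      obtain ⟨w, hw, hyw, hle'⟩ := hstep y hy
      refine ⟨y - w, hyw, ?_, ?_⟩
      · rw [show x - (y - w) = (x - y) + w by abel]
        exact W.add_mem hxy hw
      · have := h.isClosedCone.add_mem (h.isClosedCone.smul_mem hθ0 hle) hle'
        convert this using 1
        rw [pow_succ]
        module
  have hCW : C ⊆ W := by
    intro x hx
    choose y hyC hyW hle using hiter x hx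
    have h0 : Filter.Tendsto (fun n => y n) Filter.atTop (nhds 0) := by
      refine squeeze_zero_norm (a := fun n => c * (θ ^ n * ‖x‖)) (fun n => ?_) ?_
      · have := hn _ (subset_closure (hyC n)) _ (hle n)
        rwa [norm_smul, Real.norm_of_nonneg (by positivity)] at this
      · have := ((tendsto_pow_atTop_nhds_zero_of_lt_one hθ0 hθ1).mul_const ‖x‖).const_mul c
        simpa using this
    have h1 : Filter.Tendsto (fun n => x - y n) Filter.atTop (nhds x) := by
      simpa using h0.const_sub x
    exact W.closed_of_finiteDimensional.mem_of_tendsto h1 (Filter.Eventually.of_forall hyW)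
  exact Submodule.eq_top_of_nonempty_interior' W
    ⟨w₀, interior_mono hCW (by rwa [h.isOpen.interior_eq])⟩

/-- A nonzero invariant subspace meets the closure of the cone nontrivially. -/
theorem exists_mem_closure (h : IsCocompactConeAction ρ C K) (W : Submodule ℝ E)
    (hW : ∀ g, ∀ x ∈ W, ρ g x ∈ W) (hW0 : W ≠ ⊥) : ∃ f ∈ W, f ∈ closure C ∧ f ≠ 0 := by
  by_contra! hcon
  obtain ⟨w, hw, hw0⟩ := W.exists_mem_ne_zero_of_ne_bot hW0
  obtain ⟨x, hx⟩ := h.nonempty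
  obtain ⟨c, hc, hn⟩ := h.isClosedCone.exists_norm_le_norm_add W.isClosedCone
    fun x hx hxW => hcon x (by simpa using W.neg_mem hxW) hx
  obtain ⟨δ, hδ, hK⟩ := h.exists_smul_sub_mem
  obtain ⟨R, hR⟩ := h.isCompact.isBounded.exists_norm_le
  set M := c * (|R| + 1) / δ with hM
  have hMpos : 0 < M := by positivity
  have hdom : ∀ x ∈ C, ∀ x' ∈ closure C, x - x' ∈ W → M • x - x' ∈ closure C := by
    intro x hx x' hx' hxx'
    obtain ⟨g, τ, hτ, k, hk, rfl⟩ := h.cover x hx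
    set z := τ⁻¹ • ρ g⁻¹ x' with hz
    have hzx : x' = τ • ρ g z := by
      rw [hz, map_smul, ρ.clm_apply_inv, smul_inv_smul₀ hτ.ne']
    have hzC : z ∈ closure C := h.isClosedCone.smul_mem (by positivity) (h.map_mem_closure _ hx')
    have hzW : k - z ∈ W := by
      have := W.smul_mem τ⁻¹ (hW g⁻¹ _ hxx')
      rwa [map_sub, smul_sub, map_smul, ρ.clm_inv_apply, inv_smul_smul₀ hτ.ne'] at this
    have hzn : ‖z‖ ≤ c * (|R| + 1) := by
      have := hn z hzC (k - z) hzW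
      rw [add_sub_cancel] at this
      refine this.trans ?_
      gcongr
      exact (hR k hk).trans (by linarith [le_abs_self R])
    have h1 : M • k - z ∈ closure C := by
      have h2 := hK k hk z
      have h3 : (M - ‖z‖ / δ) • k ∈ closure C :=
        h.isClosedCone.smul_mem (by rw [hM, ← sub_div]; exact div_nonneg (by linarith) hδ.le)
          (subset_closure (h.subset hk))
      convert h.isClosedCone.add_mem h2 h3 using 1
      module
    have h4 := h.isClosedCone.smul_mem hτ.le (h.map_mem_closure g h1)
    rw [hzx]
    convert h4 using 1
    simp only [map_sub, map_smul]
    module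
  have hline : Continuous fun t : ℝ => x + t • w := by fun_prop
  have hclopen : IsClopen {t : ℝ | x + t • w ∈ C} := by
    refine ⟨?_, h.isOpen.preimage hline⟩
    refine isClosed_of_closure_subset fun t ht => ?_
    have hxt : M • (x + t • w) - x ∈ closure C := by
      have hcl : IsClosed {t : ℝ | M • (x + t • w) - x ∈ closure C} :=
        isClosed_closure.preimage (by fun_prop)
      refine hcl.closure_subset_iff.2 (fun s hs => ?_) ht
      exact hdom _ hs x (subset_closure hx) (by
        rw [add_sub_cancel_left]
        exact W.smul_mem _ hw)
    have h1 := h.smul_mem (t := M⁻¹) (by positivity) (h.add_mem_of_mem_closure hxt hx)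
    rw [sub_add_cancel, inv_smul_smul₀ hMpos.ne'] at h1
    exact h1
  have huniv := hclopen.eq_univ ⟨0, by simpa using hx⟩
  have hmem : ∀ t : ℝ, x + t • w ∈ C := fun t => by
    have : t ∈ {t : ℝ | x + t • w ∈ C} := huniv ▸ Set.mem_univ t
    exact this
  have hb : ∀ t : ℝ, ‖x + t • w‖ ≤ c * ‖x‖ := fun t => by
    have := hn _ (subset_closure (hmem t)) (-(t • w)) (W.neg_mem (W.smul_mem _ hw))
    simpa using this
  have h1 := hb ((c * ‖x‖ + ‖x‖ + 1) / ‖w‖)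
  have hwn : 0 < ‖w‖ := norm_pos_iff.2 hw0
  set t := (c * ‖x‖ + ‖x‖ + 1) / ‖w‖ with ht
  have h2 : ‖t • w‖ = c * ‖x‖ + ‖x‖ + 1 := by
    rw [norm_smul, Real.norm_of_nonneg (by positivity), ht, div_mul_cancel₀ _ hwn.ne']
  have h3 : ‖t • w‖ ≤ ‖x + t • w‖ + ‖x‖ := by
    simpa using norm_sub_le (x + t • w) x
  linarith

end IsCocompactConeAction

end ConeActions

section CommutatorTrick

open Filter Topology

theorem infinite_center_of_compact_mod_center {G H : Type*} [Group G] [Group H]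
    [TopologicalSpace H] [IsTopologicalGroup H] (φ : G →* H) {O : Set H} (hO : O ∈ 𝓝 1)
    (hO1 : ∀ c, φ c ∈ O → c = 1) (γ : ℕ → G) (hγ : ∀ g, {n | γ n = g}.Finite) (z : ℕ → H)
    (hz : ∀ n, z n ∈ Subgroup.center H) {Q : Set H} (hQ : IsCompact Q)
    (hmem : ∀ n, z n * φ (γ n) ∈ Q) {S : Set G} (hS : S.Finite)
    (hSc : ∀ g, (∀ s ∈ S, s * g = g * s) → g ∈ Subgroup.center G) :
    Infinite (Subgroup.center G) := by
  obtain ⟨h, -, hh⟩ := hQ.exists_mapClusterPt (u := fun n => z n * φ (γ n))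
    (f := atTop) (tendsto_principal.2 (Eventually.of_forall hmem))
  have hcomm : ∀ᶠ p : H × H in 𝓝 h ×ˢ 𝓝 h, ∀ s ∈ S,
      φ s * (p.1⁻¹ * p.2) * (φ s)⁻¹ * (p.1⁻¹ * p.2)⁻¹ ∈ O := by
    rw [hS.eventually_all, ← nhds_prod_eq]
    intro s _
    have hc : Continuous fun p : H × H =>
        φ s * (p.1⁻¹ * p.2) * (φ s)⁻¹ * (p.1⁻¹ * p.2)⁻¹ := by fun_prop
    have := hc.tendsto (h, h)
    simp only [inv_mul_cancel, mul_one, mul_inv_cancel, inv_one] at this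
    exact this.eventually hO
  obtain ⟨O', hO', hcomm'⟩ := (eventually_prod_self_iff
    (r := fun x y => ∀ s ∈ S, φ s * (x⁻¹ * y) * (φ s)⁻¹ * (x⁻¹ * y)⁻¹ ∈ O)).1 hcomm
  have hinf : {n | z n * φ (γ n) ∈ O'}.Infinite :=
    Nat.frequently_atTop_iff_infinite.1 (hh.frequently hO')
  obtain ⟨m, hm⟩ := hinf.nonempty
  have hcen : ∀ n, z n * φ (γ n) ∈ O' → (γ m)⁻¹ * γ n ∈ Subgroup.center G := by
    intro n hn
    refine hSc _ fun s hs => ?_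
    have h1 := hcomm' _ hm _ hn s hs
    have hw : (z m)⁻¹ * z n ∈ Subgroup.center H :=
      Subgroup.mul_mem _ (Subgroup.inv_mem _ (hz m)) (hz n)
    set w := (z m)⁻¹ * z n with hwdef
    have h2 : (z m * φ (γ m))⁻¹ * (z n * φ (γ n)) = w * φ ((γ m)⁻¹ * γ n) := by
      rw [_root_.mul_inv_rev, mul_assoc, ← mul_assoc (z m)⁻¹, ← hwdef, ← mul_assoc,
        Subgroup.mem_center_iff.1 hw, mul_assoc, map_mul, map_inv]
    simp only [h2] at h1
    have h3 : φ s * (w * φ ((γ m)⁻¹ * γ n)) * (φ s)⁻¹ * (w * φ ((γ m)⁻¹ * γ n))⁻¹ =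
        φ (s * ((γ m)⁻¹ * γ n) * s⁻¹ * ((γ m)⁻¹ * γ n)⁻¹) := by
      simp only [map_mul _ _ ((γ m)⁻¹ * γ n)⁻¹, map_mul _ _ s⁻¹, map_inv φ s,
        map_inv φ ((γ m)⁻¹ * γ n), map_mul φ s]
      have h4 : ∀ a, w * a * w⁻¹ = a := fun a => by
        rw [← Subgroup.mem_center_iff.1 hw, mul_inv_cancel_right]
      rw [← mul_assoc, Subgroup.mem_center_iff.1 hw, _root_.mul_inv_rev]
      simpa only [mul_assoc] using
        h4 (φ s * φ ((γ m)⁻¹ * γ n) * (φ s)⁻¹ * (φ ((γ m)⁻¹ * γ n))⁻¹)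
    rw [h3] at h1
    have h4 := hO1 _ h1
    rw [mul_inv_eq_one, mul_inv_eq_iff_eq_mul] at h4
    exact h4
  by_contra hfin
  have : Finite (Subgroup.center G) := not_infinite_iff_finite.1 hfin
  refine hinf (((Set.toFinite (Subgroup.center G : Set G)).biUnion
    fun c _ => hγ (γ m * c)).subset fun n hn => ?_)
  simp only [Set.mem_iUnion]
  exact ⟨_, hcen n hn, by simp⟩

end CommutatorTrick

section DualCone

variable {E : Type*} [NormedAddCommGroup E] [NormedSpace ℝ E]

/-- The cone of continuous linear forms that are nonnegative on `P`. -/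
def dualCone (P : Set E) : Set (E →L[ℝ] ℝ) := {φ | ∀ x ∈ P, 0 ≤ φ x}

/-- The face of the dual cone of `P` cut out by a vector. -/
def dualFace (P : Set E) (f : E) : Set (E →L[ℝ] ℝ) := {φ | φ ∈ dualCone P ∧ φ f = 0}

theorem isClosedCone_dualCone (P : Set E) : IsClosedCone (dualCone P) where
  isClosed := by
    have : dualCone P = ⋂ x ∈ P, {φ : E →L[ℝ] ℝ | 0 ≤ φ x} := by
      ext
      simp [dualCone]
    rw [this]
    exact isClosed_biInter fun x _ => isClosed_le continuous_const (by fun_prop)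
  zero_mem _ _ := le_rfl
  add_mem hx hy z hz := add_nonneg (hx z hz) (hy z hz)
  smul_mem ht hx z hz := mul_nonneg ht (hx z hz)

theorem isClosedCone_dualFace (P : Set E) (f : E) : IsClosedCone (dualFace P f) where
  isClosed := (isClosedCone_dualCone P).isClosed.inter
    (isClosed_eq (f := fun φ : E →L[ℝ] ℝ => φ f) (by fun_prop) continuous_const)
  zero_mem := ⟨(isClosedCone_dualCone P).zero_mem, rfl⟩
  add_mem hx hy := ⟨(isClosedCone_dualCone P).add_mem hx.1 hy.1, by simp [hx.2, hy.2]⟩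
  smul_mem ht hx := ⟨(isClosedCone_dualCone P).smul_mem ht hx.1, by simp [hx.2]⟩

/-- A closed cone is the set of vectors on which the dual cone is nonnegative. -/
theorem IsClosedCone.mem_of_forall_dualCone {P : Set E} (hP : IsClosedCone P) {x : E}
    (hx : ∀ φ ∈ dualCone P, 0 ≤ φ x) : x ∈ P := by
  by_contra hxP
  have hconv : Convex ℝ P := fun a ha b hb s t hs ht _ =>
    hP.add_mem (hP.smul_mem hs ha) (hP.smul_mem ht hb)
  obtain ⟨f, u, hfu, hux⟩ := geometric_hahn_banach_closed_point hconv hP.isClosed hxP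
  have hu : 0 < u := by simpa using hfu 0 hP.zero_mem
  have hneg : -f ∈ dualCone P := by
    intro a ha
    by_contra hlt
    have hfa : 0 < f a := by simpa using hlt
    have := hfu _ (hP.smul_mem (t := u / f a) (by positivity) ha)
    rw [map_smul, smul_eq_mul, div_mul_cancel₀ _ hfa.ne'] at this
    exact lt_irrefl _ this
  have := hx _ hneg
  simp only [_root_.neg_apply] at this
  linarith

theorem mul_norm_le_of_mem_dualCone {P : Set E} {φ : E →L[ℝ] ℝ} (hφ : φ ∈ dualCone P) {k : E}
    {δ : ℝ} (hδ : 0 < δ) (hk : ∀ v, ‖v‖ ≤ δ → k + v ∈ P) : δ * ‖φ‖ ≤ φ k := by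
  have h0 : 0 ≤ φ k := by simpa using hφ _ (hk 0 (by simpa using hδ.le))
  rw [← le_div_iff₀' hδ]
  refine φ.opNorm_le_bound (by positivity) fun v => ?_
  rcases eq_or_ne v 0 with rfl | hv
  · simp
  have hn : 0 < ‖v‖ := norm_pos_iff.2 hv
  have key : ∀ w : E, ‖w‖ = ‖v‖ → -φ w ≤ φ k / δ * ‖v‖ := fun w hw => by
    have h1 := hφ _ (hk ((δ / ‖v‖) • w) (by
      rw [norm_smul, Real.norm_of_nonneg (by positivity), hw, div_mul_cancel₀ _ hn.ne']))
    rw [map_add, map_smul, smul_eq_mul] at h1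
    have h2 : -φ w * (δ / ‖v‖) ≤ φ k := by linarith
    rw [← le_div_iff₀ (by positivity)] at h2
    refine h2.trans (le_of_eq ?_)
    field_simp
  rw [Real.norm_eq_abs, abs_le']
  have h1 := key v rfl
  have h2 := key (-v) (norm_neg v)
  rw [map_neg, neg_neg] at h2
  exact ⟨h2, h1⟩

/-- If a vector is positive on the face of the dual cone cut out by `f`, then adding a large
multiple of `f` moves it into the cone. -/
theorem IsClosedCone.exists_add_smul_mem [FiniteDimensional ℝ E] {P : Set E}
    (hP : IsClosedCone P) {f x : E} (hf : f ∈ P)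
    (hx : ∀ φ ∈ dualFace P f, φ ≠ 0 → 0 < φ x) :
    ∃ s₀ : ℝ, ∀ s, s₀ ≤ s → x + s • f ∈ P := by
  have : ProperSpace (E →L[ℝ] ℝ) := FiniteDimensional.proper ℝ _
  have hS : IsCompact (dualCone P ∩ Metric.sphere 0 1) :=
    (isCompact_sphere 0 1).inter_left (isClosedCone_dualCone P).isClosed
  obtain ⟨n, hn⟩ := hS.elim_directed_cover
    (fun n : ℕ => {φ : E →L[ℝ] ℝ | φ ∈ Set.univ ∧ 0 < φ x + n * max (φ f) 0})
    (fun n => by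
      simp only [Set.mem_univ, true_and]
      exact isOpen_lt continuous_const (by fun_prop))
    (by
      rintro φ ⟨hφ, hφ1⟩
      simp only [Set.mem_iUnion, Set.mem_ofPred_eq, Set.mem_univ, true_and]
      rcases (hφ f hf).eq_or_lt with h0 | h0
      · refine ⟨0, ?_⟩
        have := hx φ ⟨hφ, h0.symm⟩ (by
          rintro rfl
          simp at hφ1)
        simpa using this
      · obtain ⟨n, hn⟩ := exists_nat_gt (-φ x / φ f)
        refine ⟨n, ?_⟩
        rw [div_lt_iff₀ h0] at hn
        rw [max_eq_left h0.le]
        linarith)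
    (directed_of_isDirected_le fun m n hmn φ hφ => by
      refine ⟨trivial, hφ.2.trans_le ?_⟩
      gcongr)
  refine ⟨n, fun s hs => hP.mem_of_forall_dualCone fun φ hφ => ?_⟩
  rcases eq_or_ne φ 0 with rfl | hφ0
  · simp
  have hnφ : 0 < ‖φ‖ := norm_pos_iff.2 hφ0
  have h1 := (hn ⟨(isClosedCone_dualCone P).smul_mem (t := ‖φ‖⁻¹) (by positivity) hφ, by
    simp [norm_smul, hnφ.ne']⟩).2
  have hφf := hφ f hf
  simp only [_root_.smul_apply, smul_eq_mul] at h1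
  rw [max_eq_left (by positivity)] at h1
  have h2 : 0 < ‖φ‖⁻¹ * (φ x + n * φ f) := by
    convert h1 using 1
    ring
  have h3 : 0 < φ x + n * φ f := pos_of_mul_pos_right h2 (by positivity)
  rw [map_add, map_smul, smul_eq_mul]
  have : (n : ℝ) * φ f ≤ s * φ f := by gcongr
  linarith

end DualCone

section Contragredient

variable {E : Type*} [NormedAddCommGroup E] [NormedSpace ℝ E] {G : Type*} [Group G]

/-- The contragredient of a representation. -/
noncomputable def MonoidHom.clmDual (ρ : G →* (E →L[ℝ] E)) :
    G →* ((E →L[ℝ] ℝ) →L[ℝ] (E →L[ℝ] ℝ)) where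
  toFun g := (ContinuousLinearMap.compL ℝ E E ℝ).flip (ρ g⁻¹)
  map_one' := by
    ext
    simp
  map_mul' a b := by
    ext
    simp

@[simp] theorem MonoidHom.clmDual_apply (ρ : G →* (E →L[ℝ] E)) (g : G) (φ : E →L[ℝ] ℝ) (x : E) :
    ρ.clmDual g φ x = φ (ρ g⁻¹ x) := rfl

end Contragredient

namespace IsCocompactConeAction

variable {E : Type*} [NormedAddCommGroup E] [NormedSpace ℝ E]
  {G : Type*} [Group G] {ρ : G →* (E →L[ℝ] E)} {C K : Set E}

theorem smul_map_mem (h : IsCocompactConeAction ρ C K) {τ : ℝ} (hτ : 0 < τ) (g : G) {x : E}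
    (hx : x ∈ closure C) : τ • ρ g x ∈ closure C :=
  h.isClosedCone.smul_mem hτ.le (h.map_mem_closure g hx)

theorem exists_mul_norm_le (h : IsCocompactConeAction ρ C K) :
    ∃ δ > 0, ∀ φ ∈ dualCone (closure C), ∀ k ∈ K, δ * ‖φ‖ ≤ φ k := by
  obtain ⟨δ, hδ, hK⟩ := h.exists_ball
  exact ⟨δ, hδ, fun φ hφ k hk =>
    mul_norm_le_of_mem_dualCone hφ hδ fun v hv => subset_closure (hK k hk v hv)⟩

theorem clmDual_mem_dualCone (h : IsCocompactConeAction ρ C K) (g : G) {φ : E →L[ℝ] ℝ}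
    (hφ : φ ∈ dualCone (closure C)) : ρ.clmDual g φ ∈ dualCone (closure C) :=
  fun _ hx => hφ _ (h.map_mem_closure g⁻¹ hx)

/-- A face of the dual cone contains a nonzero form if the face of the cone lies in a subspace
disjoint from the open cone. -/
theorem exists_mem_dualFace (h : IsCocompactConeAction ρ C K) (W : Submodule ℝ E)
    (hW : ∀ x ∈ W, x ∉ C) {f₀ : E} (hf₀ : f₀ ∈ W) :
    ∃ φ ∈ dualFace (closure C) f₀, φ ≠ 0 := by
  have hconv : Convex ℝ C := fun a ha b hb s t hs ht hst => by
    rcases hs.eq_or_lt with rfl | hs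
    · rw [zero_add] at hst
      simpa [hst] using hb
    rcases ht.eq_or_lt with rfl | ht
    · rw [add_zero] at hst
      simpa [hst] using ha
    exact h.add_mem (h.smul_mem hs ha) (h.smul_mem ht hb)
  obtain ⟨φ, u, hφC, hφW⟩ := geometric_hahn_banach_open hconv h.isOpen W.convex
    (Set.disjoint_left.2 fun x hx hxW => hW x hxW hx)
  have h0 : u ≤ 0 := by simpa using hφW 0 W.zero_mem
  have hW0 : φ f₀ = 0 := by
    by_contra hne
    have := hφW _ (W.smul_mem ((u - 1) / φ f₀) hf₀)
    rw [map_smul, smul_eq_mul, div_mul_cancel₀ _ hne] at this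
    linarith
  refine ⟨-φ, ⟨fun x hx => ?_, by simp [hW0]⟩, ?_⟩
  · have : IsClosed {x : E | 0 ≤ (-φ) x} := isClosed_le continuous_const (by fun_prop)
    refine this.closure_subset_iff.2 (fun y hy => ?_) hx
    have := hφC y hy
    simp only [Set.mem_ofPred_eq, _root_.neg_apply]
    linarith
  · obtain ⟨x, hx⟩ := h.nonempty
    intro hφ
    have h1 := hφC x hx
    rw [neg_eq_zero.1 hφ] at h1
    simp only [_root_.zero_apply] at h1
    linarith

variable {F : Set E} {f₀ : E} {δ : ℝ}

theorem clmDual_mem_dualFace (h : IsCocompactConeAction ρ C K) (hF : IsClosedCone F)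
    (hFC : F ⊆ closure C) (hFρ : ∀ g, ∀ f ∈ F, ρ g f ∈ F) (hf₀ : f₀ ∈ F) (hδ : 0 < δ)
    (hrel : ∀ v ∈ Submodule.span ℝ F, ‖v‖ ≤ δ → f₀ + v ∈ F) (g : G) {φ : E →L[ℝ] ℝ}
    (hφ : φ ∈ dualFace (closure C) f₀) : ρ.clmDual g φ ∈ dualFace (closure C) f₀ := by
  refine ⟨h.clmDual_mem_dualCone g hφ.1, ?_⟩
  have h1 := hF.smul_sub_mem_of_relInterior hδ hrel (Submodule.subset_span (hFρ g⁻¹ f₀ hf₀))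
  have h2 := hφ.1 _ (hFC h1)
  have h3 := hφ.1 _ (hFC (hFρ g⁻¹ f₀ hf₀))
  rw [map_sub, map_smul, hφ.2, smul_zero, zero_sub] at h2
  rw [MonoidHom.clmDual_apply]
  linarith

variable [FiniteDimensional ℝ E]

/-- An element that moves a point of the compact set `K` by a bounded amount has bounded norm. -/
theorem exists_norm_le_of_smul_sub_mem (h : IsCocompactConeAction ρ C K) :
    ∃ M, ∀ g, ∀ k ∈ K, (3 : ℝ) • k - ρ g k ∈ closure C → ‖ρ g‖ ≤ M := by
  obtain ⟨δ, hδ, hK⟩ := h.exists_smul_sub_mem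
  obtain ⟨c, hc, hn⟩ := h.exists_norm_le_of_abs
  obtain ⟨R, hR⟩ := h.isCompact.isBounded.exists_norm_le
  refine ⟨c * (3 / δ * (|R|)), fun g k hk hg => ?_⟩
  refine ContinuousLinearMap.opNorm_le_bound _ (by positivity) fun v => ?_
  have key : ∀ w : E, ‖w‖ = ‖v‖ → (3 * (‖v‖ / δ)) • k - ρ g w ∈ closure C := fun w hw => by
    have h1 := h.map_mem_closure g (hK k hk w)
    have h2 := h.isClosedCone.smul_mem (t := ‖v‖ / δ) (by positivity) hg
    rw [hw] at h1
    convert h.isClosedCone.add_mem h1 h2 using 1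
    rw [map_sub, map_smul]
    module
  have h3 := hn (ρ g v) _ (key v rfl) (by simpa using key (-v) (norm_neg v))
  refine h3.trans ?_
  rw [norm_smul, Real.norm_of_nonneg (by positivity)]
  have := (hR k hk).trans (le_abs_self R)
  calc c * (3 * (‖v‖ / δ) * ‖k‖) ≤ c * (3 * (‖v‖ / δ) * |R|) := by gcongr
    _ = _ := by ring

theorem exists_primal_bound (h : IsCocompactConeAction ρ C K) (hF : IsClosedCone F)
    (hFC : F ⊆ closure C) (hδ : 0 < δ)
    (hrel : ∀ v ∈ Submodule.span ℝ F, ‖v‖ ≤ δ → f₀ + v ∈ F) {x₀ : E} (hx₀ : x₀ ∈ C) :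
    ∃ M, ∀ (g : G) (τ s : ℝ) (k : E), 1 ≤ s → 0 < τ → k ∈ K → x₀ + s • f₀ = τ • ρ g k →
      ∀ v ∈ Submodule.span ℝ F, ‖(τ / s) • ρ g v‖ ≤ M * ‖v‖ ∧
        ‖(τ / s)⁻¹ • ρ g⁻¹ v‖ ≤ M * ‖v‖ := by
  obtain ⟨δ', hδ', hK⟩ := h.exists_smul_sub_mem
  obtain ⟨c, hc, hn⟩ := h.exists_norm_le
  obtain ⟨R, hR⟩ := h.isCompact.isBounded.exists_norm_le
  obtain ⟨b, hb, hspan⟩ := hF.exists_bound_on_span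
  set m₁ := c * (δ'⁻¹ * (‖x₀‖ + ‖f₀‖)) with hm₁
  set m₂ := c * (δ⁻¹ * |R|) with hm₂
  have hm₁0 : 0 ≤ m₁ := by positivity
  have hm₂0 : 0 ≤ m₂ := by positivity
  refine ⟨b * m₁ + b * m₂, fun g τ s k hs hτ hk hx v hv => ?_⟩
  have hs0 : 0 < s := by linarith
  have hA := hspan ((τ / s) • (ρ g : E →ₗ[ℝ] E)) m₁ hm₁0 (fun f hf => by
    have h1 := h.smul_map_mem (div_pos hτ hs0) g (hK k hk f)
    have h2 : ‖(τ / s) • ρ g f‖ ≤ c * ‖(‖f‖ / δ' / s) • (x₀ + s • f₀)‖ := by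
      refine hn _ (h.smul_map_mem (div_pos hτ hs0) g (hFC hf)) _ ?_
      rw [hx]
      convert h1 using 1
      rw [map_sub, map_smul]
      module
    have h3 : ‖x₀ + s • f₀‖ ≤ s * (‖x₀‖ + ‖f₀‖) := by
      refine (norm_add_le _ _).trans ?_
      rw [norm_smul, Real.norm_of_nonneg hs0.le]
      nlinarith [norm_nonneg x₀]
    refine h2.trans ?_
    rw [norm_smul, Real.norm_of_nonneg (by positivity)]
    calc c * (‖f‖ / δ' / s * ‖x₀ + s • f₀‖) ≤ c * (‖f‖ / δ' / s * (s * (‖x₀‖ + ‖f₀‖))) := by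
          gcongr
      _ = m₁ * ‖f‖ := by
        rw [hm₁]
        field_simp) v hv
  have hB := hspan ((τ / s)⁻¹ • (ρ g⁻¹ : E →ₗ[ℝ] E)) m₂ hm₂0 (fun f hf => by
    have h0 := hF.smul_sub_mem_of_relInterior hδ hrel (Submodule.subset_span hf)
    have h0' := h.isClosedCone.add_mem (hFC h0)
      (h.isClosedCone.smul_mem (t := ‖f‖ / δ / s) (by positivity) (subset_closure hx₀))
    have h1 := h.smul_map_mem (inv_pos.2 (div_pos hτ hs0)) g⁻¹ h0'
    have h2 : ‖(τ / s)⁻¹ • ρ g⁻¹ f‖ ≤ c * ‖(‖f‖ / δ) • k‖ := by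
      refine hn _ (h.smul_map_mem (inv_pos.2 (div_pos hτ hs0)) g⁻¹ (hFC hf)) _ ?_
      have h3 : k = τ⁻¹ • ρ g⁻¹ (x₀ + s • f₀) := by
        rw [hx, map_smul, inv_smul_smul₀ hτ.ne', ρ.clm_inv_apply]
      convert h1 using 1
      rw [h3]
      simp only [map_add, map_sub, map_smul, inv_div]
      have e1 : s / τ * (‖f‖ / δ / s) = ‖f‖ / δ * τ⁻¹ := by field_simp
      have e2 : s / τ * (‖f‖ / δ) = ‖f‖ / δ * τ⁻¹ * s := by field_simp
      simp only [smul_add, smul_sub, smul_smul, e1, e2]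
      module
    refine h2.trans ?_
    rw [norm_smul, Real.norm_of_nonneg (by positivity)]
    have := (hR k hk).trans (le_abs_self R)
    calc c * (‖f‖ / δ * ‖k‖) ≤ c * (‖f‖ / δ * |R|) := by gcongr
      _ = m₂ * ‖f‖ := by
        rw [hm₂]
        field_simp) v hv
  have hv0 := norm_nonneg v
  have e1 : b * m₁ * ‖v‖ ≤ (b * m₁ + b * m₂) * ‖v‖ := by gcongr; linarith [mul_nonneg hb.le hm₂0]
  have e2 : b * m₂ * ‖v‖ ≤ (b * m₁ + b * m₂) * ‖v‖ := by gcongr; linarith [mul_nonneg hb.le hm₁0]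
  exact ⟨hA.trans e1, hB.trans e2⟩

theorem exists_dual_bound (h : IsCocompactConeAction ρ C K)
    (hinv : ∀ g, ∀ φ ∈ dualFace (closure C) f₀, ρ.clmDual g φ ∈ dualFace (closure C) f₀)
    {x₀ : E} (hx₀ : x₀ ∈ K) :
    ∃ M, ∀ (g : G) (τ s : ℝ) (k : E), 0 < τ → k ∈ K → x₀ + s • f₀ = τ • ρ g k →
      ∀ ψ ∈ Submodule.span ℝ (dualFace (closure C) f₀), ‖τ⁻¹ • ρ.clmDual g ψ‖ ≤ M * ‖ψ‖ ∧
        ‖(τ⁻¹)⁻¹ • ρ.clmDual g⁻¹ ψ‖ ≤ M * ‖ψ‖ := by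
  obtain ⟨δ', hδ', hK⟩ := h.exists_mul_norm_le
  obtain ⟨R, hR⟩ := h.isCompact.isBounded.exists_norm_le
  obtain ⟨b, hb, hspan⟩ := (isClosedCone_dualFace (closure C) f₀).exists_bound_on_span
  set m := δ'⁻¹ * |R| with hm
  have hm0 : 0 ≤ m := by positivity
  have hφK : ∀ φ : E →L[ℝ] ℝ, ∀ k ∈ K, φ k ≤ ‖φ‖ * |R| := fun φ k hk =>
    (le_abs_self _).trans ((φ.le_opNorm k).trans (by
      gcongr
      exact (hR k hk).trans (le_abs_self R)))
  refine ⟨b * m, fun g τ s k hτ hk hx ψ hψ => ⟨?_, ?_⟩⟩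
  · refine hspan (τ⁻¹ • (ρ.clmDual g : (E →L[ℝ] ℝ) →ₗ[ℝ] (E →L[ℝ] ℝ))) m hm0
      (fun φ hφ => ?_) ψ hψ
    have h1 := hinv g φ hφ
    have h2 := hK _ h1.1 x₀ hx₀
    have h3 : ρ.clmDual g φ x₀ = τ * φ k := by
      have : ρ.clmDual g φ (x₀ + s • f₀) = τ * φ k := by
        rw [hx, map_smul, MonoidHom.clmDual_apply, ρ.clm_inv_apply, smul_eq_mul]
      rwa [map_add, map_smul, h1.2, smul_zero, add_zero] at this
    rw [LinearMap.smul_apply, norm_smul, Real.norm_of_nonneg (by positivity)]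
    rw [h3] at h2
    change τ⁻¹ * ‖ρ.clmDual g φ‖ ≤ _
    have h4 := hφK φ k hk
    have h5 : δ' * ‖ρ.clmDual g φ‖ ≤ τ * (‖φ‖ * |R|) := h2.trans (by gcongr)
    rw [hm, inv_mul_le_iff₀ hτ]
    calc ‖ρ.clmDual g φ‖ = δ'⁻¹ * (δ' * ‖ρ.clmDual g φ‖) := by field_simp
      _ ≤ δ'⁻¹ * (τ * (‖φ‖ * |R|)) := by gcongr
      _ = _ := by ring
  · rw [inv_inv]
    refine hspan (τ • (ρ.clmDual g⁻¹ : (E →L[ℝ] ℝ) →ₗ[ℝ] (E →L[ℝ] ℝ))) m hm0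
      (fun φ hφ => ?_) ψ hψ
    have h1 := hinv g⁻¹ φ hφ
    have h2 := hK _ h1.1 k hk
    have h3 : τ * ρ.clmDual g⁻¹ φ k = φ x₀ := by
      have : φ (x₀ + s • f₀) = τ * ρ.clmDual g⁻¹ φ k := by
        rw [hx, map_smul, MonoidHom.clmDual_apply, inv_inv, smul_eq_mul]
      rw [← this, map_add, map_smul, hφ.2, smul_zero, add_zero]
    rw [LinearMap.smul_apply, norm_smul, Real.norm_of_nonneg hτ.le]
    change τ * ‖ρ.clmDual g⁻¹ φ‖ ≤ _
    calc τ * ‖ρ.clmDual g⁻¹ φ‖ = δ'⁻¹ * (τ * (δ' * ‖ρ.clmDual g⁻¹ φ‖)) := by field_simp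
      _ ≤ δ'⁻¹ * (τ * ρ.clmDual g⁻¹ φ k) := by gcongr
      _ = δ'⁻¹ * φ x₀ := by rw [h3]
      _ ≤ δ'⁻¹ * (‖φ‖ * |R|) := by
        gcongr
        exact hφK φ x₀ hx₀
      _ = _ := by rw [hm]; ring

/-- Elements acting almost trivially on a face and on the dual face displace the points
`x₀ + s • f₀` by a bounded amount as `s → ∞`. -/
theorem exists_smul_sub_mem_of_near (h : IsCocompactConeAction ρ C K)
    (hFC : F ⊆ closure C) (hFρ : ∀ g, ∀ f ∈ F, ρ g f ∈ F) (hf₀ : f₀ ∈ F) (hδ : 0 < δ)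
    (hrel : ∀ v ∈ Submodule.span ℝ F, ‖v‖ ≤ δ → f₀ + v ∈ F) {x₀ : E} (hx₀ : x₀ ∈ K) :
    ∃ ε > 0, ∀ g, ‖ρ g f₀ - f₀‖ ≤ ε →
      (∀ φ ∈ dualFace (closure C) f₀, ‖ρ.clmDual g⁻¹ φ - φ‖ ≤ ε * ‖φ‖) →
      ∃ s₀ : ℝ, ∀ s, s₀ ≤ s → (3 : ℝ) • (x₀ + s • f₀) - ρ g (x₀ + s • f₀) ∈ closure C := by
  obtain ⟨δ', hδ', hK⟩ := h.exists_mul_norm_le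
  refine ⟨min δ (δ' / (‖x₀‖ + 1)), by positivity, fun g hgf hgφ => ?_⟩
  have hspan : ρ g f₀ - f₀ ∈ Submodule.span ℝ F :=
    Submodule.sub_mem _ (Submodule.subset_span (hFρ g f₀ hf₀)) (Submodule.subset_span hf₀)
  have h1 := hrel _ (Submodule.neg_mem _ hspan) (by
    rw [norm_neg]
    exact hgf.trans (min_le_left _ _))
  have hpos : ∀ φ ∈ dualFace (closure C) f₀, φ ≠ 0 → 0 < φ ((3 : ℝ) • x₀ - ρ g x₀) := by
    intro φ hφ hφ0
    have hnφ : 0 < ‖φ‖ := norm_pos_iff.2 hφ0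
    have h2 := hgφ φ hφ
    have h3 : |φ (ρ g x₀) - φ x₀| ≤ δ' * ‖φ‖ := by
      have e1 : φ (ρ g x₀) - φ x₀ = (ρ.clmDual g⁻¹ φ - φ) x₀ := by simp
      rw [e1, ← Real.norm_eq_abs]
      refine (ContinuousLinearMap.le_opNorm _ _).trans ?_
      calc _ ≤ (δ' / (‖x₀‖ + 1) * ‖φ‖) * (‖x₀‖ + 1) := by
            gcongr
            · exact h2.trans (by gcongr; exact min_le_right _ _)
            · linarith
        _ = δ' * ‖φ‖ := by field_simp
    have h4 := hK φ hφ.1 x₀ hx₀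
    have h5 := (abs_le.1 h3).2
    rw [map_sub, map_smul, smul_eq_mul]
    have : 0 < δ' * ‖φ‖ := by positivity
    linarith
  obtain ⟨s₀, hs₀⟩ := h.isClosedCone.exists_add_smul_mem (hFC hf₀) hpos
  refine ⟨max s₀ 0, fun s hs => ?_⟩
  have h6 := h.isClosedCone.add_mem (hs₀ s ((le_max_left _ _).trans hs))
    (h.isClosedCone.smul_mem (t := s) ((le_max_right _ _).trans hs) (hFC h1))
  convert h6 using 1
  simp only [map_add, map_smul]
  module

/-- Conjugates of elements acting almost trivially on a face and on the dual face are
eventually bounded. -/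
theorem exists_conj_bound (h : IsCocompactConeAction ρ C K)
    (hFC : F ⊆ closure C) (hFρ : ∀ g, ∀ f ∈ F, ρ g f ∈ F) (hf₀ : f₀ ∈ F) (hδ : 0 < δ)
    (hrel : ∀ v ∈ Submodule.span ℝ F, ‖v‖ ≤ δ → f₀ + v ∈ F) {x₀ : E} (hx₀ : x₀ ∈ K) :
    ∃ ε > 0, ∃ M, ∀ c, ‖ρ c f₀ - f₀‖ ≤ ε →
      (∀ φ ∈ dualFace (closure C) f₀, ‖ρ.clmDual c⁻¹ φ - φ‖ ≤ ε * ‖φ‖) →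
      ∃ s₀ : ℝ, ∀ (g : G) (τ s : ℝ) (k : E), s₀ ≤ s → 0 < τ → k ∈ K →
        x₀ + s • f₀ = τ • ρ g k → ‖ρ (g⁻¹ * c * g)‖ ≤ M := by
  obtain ⟨ε, hε, hnear⟩ := h.exists_smul_sub_mem_of_near hFC hFρ hf₀ hδ hrel hx₀
  obtain ⟨M, hM⟩ := h.exists_norm_le_of_smul_sub_mem
  refine ⟨ε, hε, M, fun c hc hc' => ?_⟩
  obtain ⟨s₀, hs₀⟩ := hnear c hc hc'
  refine ⟨s₀, fun g τ s k hs hτ hk hx => hM _ k hk ?_⟩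
  have h1 := h.smul_map_mem (inv_pos.2 hτ) g⁻¹ (hs₀ s hs)
  rw [hx] at h1
  convert h1 using 1
  simp only [map_sub, map_smul, map_mul, mul_apply_eq_comp, ρ.clm_inv_apply, smul_sub]
  rw [smul_comm τ⁻¹ (3 : ℝ), inv_smul_smul₀ hτ.ne', inv_smul_smul₀ hτ.ne']

end IsCocompactConeAction

section CompactModCenter

open Filter Topology

theorem exists_nhds_of_conj {G H : Type*} [Group G] [Group H] [TopologicalSpace H]
    [IsTopologicalGroup H] [T1Space H] (φ : G →* H) (γ : ℕ → G) (z : ℕ → H)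
    (hz : ∀ n, z n ∈ Subgroup.center H) {Q : Set H} (hQ : IsCompact Q)
    (hmem : ∀ n, z n * φ (γ n) ∈ Q) {S : Set G} (hS : S.Finite) {N : Set H} (hN : N ∈ 𝓝 1)
    (hconj : ∀ c, φ c ∈ N → ∀ᶠ n in atTop, (γ n)⁻¹ * c * γ n ∈ S) :
    ∃ O ∈ 𝓝 (1 : H), ∀ c, φ c ∈ O → φ c = 1 := by
  have hA : IsClosed ((φ '' S) \ {1}) := ((hS.image φ).subset Set.sdiff_subset).isClosed
  have hev : ∀ᶠ u in 𝓝 (1 : H), ∀ y ∈ Q, y⁻¹ * u * y ∉ (φ '' S) \ {1} := by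
    refine hQ.eventually_forall_of_forall_eventually
      (P := fun u y => y⁻¹ * u * y ∉ (φ '' S) \ {1}) fun y _ => ?_
    have hc : Continuous fun p : H × H => p.2⁻¹ * p.1 * p.2 := by fun_prop
    have := hc.tendsto (1, y)
    simp only [mul_one, inv_mul_cancel] at this
    exact this.eventually (hA.isOpen_compl.mem_nhds (by simp))
  refine ⟨_, inter_mem hN hev, fun c hc => ?_⟩
  obtain ⟨n, hn⟩ := (hconj c hc.1).exists
  have h1 : (z n * φ (γ n))⁻¹ * φ c * (z n * φ (γ n)) = φ ((γ n)⁻¹ * c * γ n) := by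
    have h2 : ∀ a, (z n)⁻¹ * a * z n = a := fun a => by
      rw [mul_assoc, Subgroup.mem_center_iff.1 (hz n), inv_mul_cancel_left]
    conv_rhs => rw [map_mul, map_mul, map_inv, ← h2 (φ c)]
    group
  have h2 := hc.2 _ (hmem n)
  rw [h1] at h2
  have h3 : φ ((γ n)⁻¹ * c * γ n) = 1 := by
    by_contra hne
    exact h2 ⟨⟨_, hn, rfl⟩, hne⟩
  rw [map_mul, map_mul, map_inv, mul_eq_one_iff_eq_inv, mul_eq_left] at h3
  exact h3

theorem finite_ker_of_conj {G H : Type*} [Group G] [Group H] (φ : G →* H) (γ : ℕ → G)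
    {S : Set G} (hS : S.Finite)
    (hconj : ∀ c, φ c = 1 → ∀ᶠ n in atTop, (γ n)⁻¹ * c * γ n ∈ S) :
    (φ.ker : Set G).Finite := by
  by_contra hinf
  obtain ⟨T, hT, hcard⟩ := Set.Infinite.exists_subset_card_eq hinf (hS.toFinset.card + 1)
  have hev : ∀ᶠ n in atTop, ∀ c ∈ T, (γ n)⁻¹ * c * γ n ∈ S :=
    (eventually_all_finset T).2 fun c hc => hconj c (hT hc)
  obtain ⟨n, hn⟩ := hev.exists
  have := Finset.card_le_card_of_injOn (s := T) (t := hS.toFinset)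
    (fun c => (γ n)⁻¹ * c * γ n) (fun c hc => by simpa using hn c hc)
    (fun a _ b _ hab => by simpa using hab)
  omega

end CompactModCenter

section Subrepresentation

variable {E : Type*} [NormedAddCommGroup E] [NormedSpace ℝ E] {G : Type*} [Group G]

/-- The subrepresentation on an invariant subspace, with values in the invertible operators. -/
noncomputable def MonoidHom.clmRestrict (ρ : G →* (E →L[ℝ] E)) (V : Submodule ℝ E)
    (hV : ∀ g, ∀ x ∈ V, ρ g x ∈ V) : G →* (V →L[ℝ] V)ˣ :=
  MonoidHom.toHomUnits
    { toFun := fun g => ((ρ g).comp V.subtypeL).codRestrict V fun x => hV g x x.2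
      map_one' := by
        ext
        simp
      map_mul' := fun a b => by
        ext
        simp only [map_mul]
        rfl }

/-- Homotheties as invertible operators. -/
noncomputable def scalarUnit (E : Type*) [NormedAddCommGroup E] [NormedSpace ℝ E] :
    ℝˣ →* (E →L[ℝ] E)ˣ :=
  Units.map (algebraMap ℝ (E →L[ℝ] E)).toMonoidHom

theorem scalarUnit_mem_center (a : ℝˣ) :
    scalarUnit E a ∈ Subgroup.center (E →L[ℝ] E)ˣ := by
  rw [Subgroup.mem_center_iff]
  intro u
  ext1
  exact (Algebra.commutes (a : ℝ) (u : E →L[ℝ] E)).symm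

theorem isCompact_units_norm_le (E : Type*) [NormedAddCommGroup E] [NormedSpace ℝ E]
    [FiniteDimensional ℝ E] (M : ℝ) :
    IsCompact {u : (E →L[ℝ] E)ˣ | ‖(u : E →L[ℝ] E)‖ ≤ M ∧
      ‖((u⁻¹ : (E →L[ℝ] E)ˣ) : E →L[ℝ] E)‖ ≤ M} := by
  have : ProperSpace (E →L[ℝ] E) := FiniteDimensional.proper ℝ _
  have h1 := ((isCompact_closedBall (0 : E →L[ℝ] E) M).prod
    ((isCompact_closedBall (0 : E →L[ℝ] E) M).image MulOpposite.continuous_op))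
  convert Units.isClosedEmbedding_embedProduct.isCompact_preimage h1 using 1
  ext u
  simp

theorem MonoidHom.scalarUnit_mul_clmRestrict_mem (ρ : G →* (E →L[ℝ] E)) (V : Submodule ℝ E)
    (hV : ∀ g, ∀ x ∈ V, ρ g x ∈ V) {M : ℝ} (hM : 0 ≤ M) (a : ℝˣ) (g : G)
    (h : ∀ v ∈ V, ‖(a : ℝ) • ρ g v‖ ≤ M * ‖v‖ ∧ ‖(a : ℝ)⁻¹ • ρ g⁻¹ v‖ ≤ M * ‖v‖) :
    scalarUnit V a * ρ.clmRestrict V hV g ∈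
      {u : (V →L[ℝ] V)ˣ | ‖(u : V →L[ℝ] V)‖ ≤ M ∧ ‖((u⁻¹ : (V →L[ℝ] V)ˣ) : V →L[ℝ] V)‖ ≤ M} := by
  have hcomm := Subgroup.mem_center_iff.1 (scalarUnit_mem_center (E := V) a⁻¹)
    (ρ.clmRestrict V hV g⁻¹)
  have hinv : (scalarUnit V a * ρ.clmRestrict V hV g)⁻¹ =
      scalarUnit V a⁻¹ * ρ.clmRestrict V hV g⁻¹ := by
    rw [_root_.mul_inv_rev, ← map_inv, ← map_inv, hcomm]
  refine ⟨ContinuousLinearMap.opNorm_le_bound _ hM fun v => (h v v.2).1, ?_⟩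
  rw [hinv]
  refine ContinuousLinearMap.opNorm_le_bound _ hM fun v => ?_
  have := (h v v.2).2
  rwa [← Units.val_inv_eq_inv_val] at this

theorem isTopologicalGroup_clm_units (E : Type*) [NormedAddCommGroup E] [NormedSpace ℝ E] :
    IsTopologicalGroup (E →L[ℝ] E)ˣ :=
  inferInstance

theorem t1Space_clm_units (E : Type*) [NormedAddCommGroup E] [NormedSpace ℝ E] :
    T1Space (E →L[ℝ] E)ˣ :=
  inferInstance

theorem exists_nhds_one_norm_sub_le (E : Type*) [NormedAddCommGroup E] [NormedSpace ℝ E]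
    {ε : ℝ} (hε : 0 < ε) :
    ∃ N ∈ nhds (1 : (E →L[ℝ] E)ˣ), ∀ u ∈ N, ∀ v : E, ‖(u : E →L[ℝ] E) v - v‖ ≤ ε * ‖v‖ := by
  refine ⟨{u | ‖(u : E →L[ℝ] E) - 1‖ < ε}, IsOpen.mem_nhds ?_ ?_, fun u hu v => ?_⟩
  · exact isOpen_lt (Units.continuous_val.sub continuous_const).norm continuous_const
  · rw [Set.mem_ofPred_eq, Units.val_one, sub_self]
    exact norm_zero.trans_lt hε
  · have h1 := ((u : E →L[ℝ] E) - 1).le_opNorm v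
    have h2 : ‖(u : E →L[ℝ] E) - 1‖ ≤ ε := le_of_lt hu
    exact h1.trans (by gcongr)

theorem MonoidHom.exists_nhds_one_norm_map_sub_le (ρ : G →* (E →L[ℝ] E)) (V : Submodule ℝ E)
    (hV : ∀ g, ∀ x ∈ V, ρ g x ∈ V) {ε : ℝ} (hε : 0 < ε) :
    ∃ N ∈ nhds (1 : (V →L[ℝ] V)ˣ), ∀ g, ρ.clmRestrict V hV g ∈ N →
      ∀ v ∈ V, ‖ρ g v - v‖ ≤ ε * ‖v‖ := by
  obtain ⟨N, hN, hN'⟩ := exists_nhds_one_norm_sub_le V hε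
  exact ⟨N, hN, fun g hg v hv => hN' _ hg ⟨v, hv⟩⟩

end Subrepresentation

namespace IsCocompactConeAction

open Filter Topology

variable {E : Type*} [NormedAddCommGroup E] [NormedSpace ℝ E]
  {G : Type*} [Group G] {ρ : G →* (E →L[ℝ] E)} {C K : Set E}

/-- A finite normal subgroup acts trivially. -/
theorem map_eq_one_of_finite_normal [FiniteDimensional ℝ E]
    (h : IsCocompactConeAction ρ C K) (N : Subgroup G) [N.Normal]
    [Finite N] {c : G} (hc : c ∈ N) : ρ c = 1 := by
  have := Fintype.ofFinite N
  let V : Submodule ℝ E :=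
    { carrier := {x | ∀ c ∈ N, ρ c x = x}
      zero_mem' := fun c _ => map_zero _
      add_mem' := fun hx hy c hc => by rw [map_add, hx c hc, hy c hc]
      smul_mem' := fun t x hx c hc => by rw [map_smul, hx c hc] }
  obtain ⟨x, hx⟩ := h.nonempty
  have htop : V = ⊤ := by
    refine h.eq_top_of_mem V (fun g x hx c hc => ?_) (w₀ := ∑ a : N, ρ a x) (fun c hc => ?_) ?_
    · have h1 := hx _ (‹N.Normal›.conj_mem' c hc g)
      rw [← mul_apply_eq_comp, ← map_mul, show c * g = g * (g⁻¹ * c * g) by group, map_mul,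
        mul_apply_eq_comp, h1]
    · rw [map_sum]
      refine Fintype.sum_equiv (Equiv.mulLeft (⟨c, hc⟩ : N)) _ _ fun a => ?_
      simp
    · exact Finset.sum_induction_nonempty _ (· ∈ C) (fun a b => h.add_mem) (by simp)
        fun a _ => h.map_mem _ hx
  ext x
  have : x ∈ V := htop ▸ Submodule.mem_top
  exact this c hc

theorem finite_fiber (h : IsCocompactConeAction ρ C K) {x₀ f₀ : E} (hf₀ : f₀ ≠ 0)
    {φ : E →L[ℝ] ℝ} (hφ0 : φ ≠ 0) (hφ : φ ∈ dualFace (closure C) f₀) {γ : ℕ → G} {τ : ℕ → ℝ}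
    {k : ℕ → E} (hτ : ∀ n, 0 < τ n) (hk : ∀ n, k n ∈ K)
    (hx : ∀ n : ℕ, x₀ + ((n : ℝ) + 1) • f₀ = τ n • ρ (γ n) (k n)) (g : G) :
    {n | γ n = g}.Finite := by
  obtain ⟨δ, hδ, hK⟩ := h.exists_mul_norm_le
  obtain ⟨R, hR⟩ := h.isCompact.isBounded.exists_norm_le
  have hφg : ρ.clmDual g⁻¹ φ ≠ 0 := fun h0 => hφ0 (by
    rw [← ρ.clmDual.clm_apply_inv g φ, h0, map_zero])
  set a := δ * ‖ρ.clmDual g⁻¹ φ‖ with ha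
  have hapos : 0 < a := mul_pos hδ (norm_pos_iff.2 hφg)
  have hf₀n : 0 < ‖f₀‖ := norm_pos_iff.2 hf₀
  refine (Set.finite_Iic ⌊(φ x₀ / a * (‖ρ g‖ * |R|) + ‖x₀‖) / ‖f₀‖⌋₊).subset fun n hn => ?_
  have hn' : γ n = g := hn
  have hx' := hx n
  rw [hn'] at hx'
  have h1 : φ x₀ = τ n * ρ.clmDual g⁻¹ φ (k n) := by
    have := congrArg φ hx'
    rw [map_add, map_smul, hφ.2, smul_zero, add_zero, map_smul, smul_eq_mul] at this
    rw [this, MonoidHom.clmDual_apply, inv_inv]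
  have h2 : τ n ≤ φ x₀ / a := by
    rw [le_div_iff₀ hapos, h1]
    have := hK _ (h.clmDual_mem_dualCone g⁻¹ hφ.1) (k n) (hk n)
    have := (hτ n).le
    gcongr
  have h3 : ‖x₀ + ((n : ℝ) + 1) • f₀‖ ≤ φ x₀ / a * (‖ρ g‖ * |R|) := by
    rw [hx', norm_smul, Real.norm_of_nonneg (hτ n).le]
    have := (hτ n).le.trans h2
    gcongr
    exact ((ρ g).le_opNorm _).trans (by
      gcongr
      exact (hR _ (hk n)).trans (le_abs_self R))
  have h4 : ((n : ℝ) + 1) * ‖f₀‖ ≤ ‖x₀ + ((n : ℝ) + 1) • f₀‖ + ‖x₀‖ := by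
    have := norm_sub_le (x₀ + ((n : ℝ) + 1) • f₀) x₀
    rwa [add_sub_cancel_left, norm_smul, Real.norm_of_nonneg (by positivity)] at this
  refine Nat.le_floor ?_
  rw [le_div_iff₀ hf₀n]
  nlinarith

theorem exists_finite_forall_commute_mem_center [FiniteDimensional ℝ E]
    (hρ : Function.Injective ρ) :
    ∃ S : Set G, S.Finite ∧ ∀ g, (∀ s ∈ S, s * g = g * s) → g ∈ Subgroup.center G := by
  obtain ⟨b, hb, hspan, hli⟩ := exists_linearIndependent ℝ (Set.range ρ)
  have : Finite b := hli.finite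
  choose s hs using fun i : b => hb i.2
  refine ⟨Set.range s, Set.finite_range s, fun g hg => Subgroup.mem_center_iff.2 fun x => ?_⟩
  have hle : Submodule.span ℝ (Set.range ρ) ≤
      Subalgebra.toSubmodule (Subalgebra.centralizer ℝ {ρ g}) := by
    rw [← hspan]
    refine Submodule.span_le.2 fun T hT => ?_
    have h1 := congrArg ρ (hg _ ⟨⟨T, hT⟩, rfl⟩)
    rw [map_mul, map_mul, hs] at h1
    exact (Subalgebra.mem_centralizer_iff ℝ).2 fun a ha => by rw [ha]; exact h1.symm
  have h2 : ρ x ∈ Subalgebra.centralizer ℝ {ρ g} := hle (Submodule.subset_span ⟨x, rfl⟩)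
  rw [Subalgebra.mem_centralizer_iff] at h2
  refine hρ ?_
  rw [map_mul, map_mul, h2 _ rfl]

theorem span_invariant (F : Set E) (hF : ∀ g, ∀ f ∈ F, ρ g f ∈ F) (g : G) :
    ∀ x ∈ Submodule.span ℝ F, ρ g x ∈ Submodule.span ℝ F := by
  intro x hx
  induction hx using Submodule.span_induction with
  | mem x hx => exact Submodule.subset_span (hF g x hx)
  | zero => simp
  | add x y _ _ hx hy =>
    rw [map_add]
    exact Submodule.add_mem _ hx hy
  | smul t x _ hx =>
    rw [map_smul]
    exact Submodule.smul_mem _ _ hx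

/-- A faithful discrete cocompact group of automorphisms of a sharp cone that preserves a
proper nonzero subspace has infinite center. -/
theorem infinite_center [FiniteDimensional ℝ E] (h : IsCocompactConeAction ρ C K)
    (hρ : Function.Injective ρ) (hfin : ∀ M : ℝ, {g | ‖ρ g‖ ≤ M ∧ ‖ρ g⁻¹‖ ≤ M}.Finite)
    (W : Submodule ℝ E) (hW : ∀ g, ∀ x ∈ W, ρ g x ∈ W) (hW0 : W ≠ ⊥) (hW1 : W ≠ ⊤) :
    Infinite (Subgroup.center G) := by
  have hWC : ∀ x ∈ W, x ∉ C := fun x hx hxC => hW1 (h.eq_top_of_mem W hW hx hxC)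
  obtain ⟨f, hfW, hfC, hf0⟩ := h.exists_mem_closure W hW hW0
  set F : Set E := closure C ∩ W with hFdef
  have hF : IsClosedCone F := h.isClosedCone.inter W.isClosedCone
  have hFC : F ⊆ closure C := Set.inter_subset_left
  have hFρ : ∀ g, ∀ f ∈ F, ρ g f ∈ F := fun g f hf => ⟨h.map_mem_closure g hf.1, hW g f hf.2⟩
  obtain ⟨f₀, hf₀, δ, hδ, hrel⟩ := hF.exists_relInterior
  have hf₀0 : f₀ ≠ 0 := by
    rintro rfl
    have := hF.smul_sub_mem_of_relInterior hδ hrel (Submodule.subset_span ⟨hfC, hfW⟩)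
    rw [smul_zero, zero_sub] at this
    exact hf0 (h.salient f hfC this.1)
  obtain ⟨ψ, hψ, hψ0⟩ := h.exists_mem_dualFace W hWC hf₀.2
  obtain ⟨x₀, hx₀⟩ : K.Nonempty := by
    obtain ⟨x, hx⟩ := h.nonempty
    obtain ⟨_, _, _, k, hk, _⟩ := h.cover x hx
    exact ⟨k, hk⟩
  set F' := dualFace (closure C) f₀ with hF'def
  have hF'ρ : ∀ g, ∀ φ ∈ F', ρ.clmDual g φ ∈ F' := fun g φ hφ =>
    h.clmDual_mem_dualFace hF hFC hFρ hf₀ hδ hrel g hφ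
  obtain ⟨M₁, hM₁⟩ := h.exists_primal_bound hF hFC hδ hrel (h.subset hx₀)
  obtain ⟨M₂, hM₂⟩ := h.exists_dual_bound hF'ρ hx₀
  obtain ⟨ε, hε, M, hM⟩ := h.exists_conj_bound hFC hFρ hf₀ hδ hrel hx₀
  have hxC : ∀ n : ℕ, x₀ + ((n : ℝ) + 1) • f₀ ∈ C := fun n => by
    rw [add_comm]
    exact h.add_mem_of_mem_closure (h.isClosedCone.smul_mem (by positivity) (hFC hf₀))
      (h.subset hx₀)
  choose γ τ hτ k hk hx using fun n => h.cover _ (hxC n)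
  set V₁ := Submodule.span ℝ F
  set V₂ := Submodule.span ℝ F'
  have hV₁ := span_invariant (ρ := ρ) F hFρ
  have hV₂ := span_invariant (ρ := ρ.clmDual) F' hF'ρ
  let φ := (ρ.clmRestrict V₁ hV₁).prod (ρ.clmDual.clmRestrict V₂ hV₂)
  have hs : ∀ n : ℕ, ((n : ℝ) + 1) ≠ 0 := fun n => by positivity
  let z : ℕ → (V₁ →L[ℝ] V₁)ˣ × (V₂ →L[ℝ] V₂)ˣ := fun n =>
    (scalarUnit V₁ (Units.mk0 (τ n / ((n : ℝ) + 1)) (div_ne_zero (hτ n).ne' (hs n))),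
      scalarUnit V₂ (Units.mk0 (τ n)⁻¹ (inv_ne_zero (hτ n).ne')))
  have hz : ∀ n, z n ∈ Subgroup.center _ := fun n => by
    rw [Subgroup.mem_center_iff]
    exact fun p => Prod.ext (Subgroup.mem_center_iff.1 (scalarUnit_mem_center (E := V₁) _) p.1)
      (Subgroup.mem_center_iff.1 (scalarUnit_mem_center (E := V₂) _) p.2)
  have hQ := (isCompact_units_norm_le V₁ |M₁|).prod
    (isCompact_units_norm_le V₂ |M₂|)
  have hmem : ∀ n, z n * φ (γ n) ∈ _ := fun n => Set.mk_mem_prod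
    (ρ.scalarUnit_mul_clmRestrict_mem V₁ hV₁ (abs_nonneg M₁) _ (γ n) fun v hv => by
      have := hM₁ (γ n) (τ n) _ (k n) (by simp) (hτ n) (hk n) (hx n) v hv
      exact ⟨this.1.trans (by gcongr; exact le_abs_self _),
        this.2.trans (by gcongr; exact le_abs_self _)⟩)
    (ρ.clmDual.scalarUnit_mul_clmRestrict_mem V₂ hV₂ (abs_nonneg M₂) _ (γ n) fun v hv => by
      have := hM₂ (γ n) (τ n) _ (k n) (hτ n) (hk n) (hx n) v hv
      exact ⟨this.1.trans (by gcongr; exact le_abs_self _),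
        this.2.trans (by gcongr; exact le_abs_self _)⟩)
  set ε' := min ε (ε / (‖f₀‖ + 1)) with hε'
  have hε'pos : 0 < ε' := by positivity
  obtain ⟨N₁, hN₁, hN₁'⟩ := ρ.exists_nhds_one_norm_map_sub_le V₁ hV₁ hε'pos
  obtain ⟨N₂, hN₂, hN₂'⟩ := ρ.clmDual.exists_nhds_one_norm_map_sub_le V₂ hV₂ hε'pos
  have := isTopologicalGroup_clm_units V₁
  have := isTopologicalGroup_clm_units V₂
  have := t1Space_clm_units V₁
  have := t1Space_clm_units V₂
  set N₀ := N₁ ×ˢ N₂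
  have hN₀ : N₀ ∈ 𝓝 1 := prod_mem_nhds hN₁ hN₂
  have hbd : ∀ c, φ c ∈ N₀ → φ c⁻¹ ∈ N₀ → ∀ᶠ n in atTop, ‖ρ ((γ n)⁻¹ * c * γ n)‖ ≤ M := by
    intro c hc hc'
    obtain ⟨s₀, hs₀⟩ := hM c (by
      refine (hN₁' c hc.1 f₀ (Submodule.subset_span hf₀)).trans ?_
      calc ε' * ‖f₀‖ ≤ (ε / (‖f₀‖ + 1)) * (‖f₀‖ + 1) := by
            gcongr
            · exact min_le_right _ _
            · linarith
        _ = ε := by field_simp) (fun ξ hξ => by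
      refine (hN₂' c⁻¹ hc'.2 ξ (Submodule.subset_span hξ)).trans ?_
      gcongr
      exact min_le_left _ _)
    filter_upwards [eventually_ge_atTop ⌈s₀⌉₊] with n hn
    refine hs₀ (γ n) (τ n) _ (k n) ?_ (hτ n) (hk n) (hx n)
    have : s₀ ≤ n := Nat.ceil_le.1 hn
    linarith
  have hconj : ∀ c, φ c ∈ N₀ ∩ N₀⁻¹ → ∀ᶠ n in atTop,
      (γ n)⁻¹ * c * γ n ∈ {g | ‖ρ g‖ ≤ M ∧ ‖ρ g⁻¹‖ ≤ M} := by
    intro c hc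
    have hc' : φ c⁻¹ ∈ N₀ := by
      rw [map_inv]
      exact hc.2
    filter_upwards [hbd c hc.1 hc', hbd c⁻¹ hc' (by rw [inv_inv]; exact hc.1)] with n h1 h2
    refine ⟨h1, ?_⟩
    rwa [show ((γ n)⁻¹ * c * γ n)⁻¹ = (γ n)⁻¹ * c⁻¹ * γ n by group]
  have hN : N₀ ∩ N₀⁻¹ ∈ 𝓝 1 := inter_mem hN₀ (inv_mem_nhds_one _ hN₀)
  obtain ⟨O, hO, hO1⟩ := exists_nhds_of_conj φ γ z hz hQ hmem (hfin M) hN hconj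
  have hker : (φ.ker : Set G).Finite := finite_ker_of_conj φ γ (hfin M) fun c hc =>
    hconj c (by rw [hc]; exact mem_of_mem_nhds hN)
  have : Finite φ.ker := hker
  obtain ⟨S, hS, hSc⟩ := exists_finite_forall_commute_mem_center hρ
  refine infinite_center_of_compact_mod_center φ hO (fun c hc => hρ ?_) γ
    (h.finite_fiber hf₀0 hψ0 hψ hτ hk hx) z hz hQ hmem hS hSc
  rw [map_one]
  exact h.map_eq_one_of_finite_normal φ.ker (hO1 c hc)

end IsCocompactConeAction

section PerronFrobenius

variable {E : Type*} [NormedAddCommGroup E] [NormedSpace ℝ E] [FiniteDimensional ℝ E]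

/-- A salient closed cone admits a linear form positive on its nonzero vectors. -/
theorem IsClosedCone.exists_strictly_positive {P : Set E} (hP : IsClosedCone P)
    (hsal : ∀ x ∈ P, -x ∈ P → x = 0) :
    ∃ φ : E →L[ℝ] ℝ, φ ∈ dualCone P ∧ ∀ x ∈ P, x ≠ 0 → 0 < φ x := by
  obtain ⟨φ, hφ, δ, hδ, hrel⟩ := (isClosedCone_dualCone P).exists_relInterior
  refine ⟨φ, hφ, fun x hx hx0 => (hφ x hx).lt_of_ne fun h0 => hx0 (hsal x hx ?_)⟩
  refine hP.mem_of_forall_dualCone fun ψ hψ => ?_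
  have h1 := (isClosedCone_dualCone P).smul_sub_mem_of_relInterior hδ hrel
    (Submodule.subset_span hψ) x hx
  simp only [_root_.sub_apply, _root_.smul_apply, smul_eq_mul, ← h0, mul_zero] at h1
  rw [map_neg]
  linarith

/-- The Perron–Frobenius theorem for a perturbed operator. -/
theorem IsClosedCone.exists_perturbed_eigenvector {P : Set E} (hP : IsClosedCone P)
    (hsal : ∀ x ∈ P, -x ∈ P → x = 0) (hP0 : ∃ x ∈ P, x ≠ 0) (T : E →L[ℝ] E)
    (hT : ∀ x ∈ P, T x ∈ P) {φ : E →L[ℝ] ℝ} (hφ : φ ∈ dualCone P)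
    (hφ0 : ∀ x ∈ P, x ≠ 0 → 0 < φ x) {f₀ : E} {δ : ℝ} (hf₀ : f₀ ∈ P) (hδ : 0 < δ)
    (hrel : ∀ v ∈ Submodule.span ℝ P, ‖v‖ ≤ δ → f₀ + v ∈ P) {ε : ℝ} (hε : 0 < ε) :
    ∃ r : ℝ, ∃ v ∈ P, ‖v‖ = 1 ∧ T v + (ε * φ v) • f₀ = r • v := by
  have : ProperSpace E := FiniteDimensional.proper ℝ E
  have hS : IsCompact (P ∩ Metric.sphere 0 1) := (isCompact_sphere 0 1).inter_left hP.isClosed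
  obtain ⟨x₁, hx₁, hx₁0⟩ := hP0
  have normalize : ∀ x ∈ P, x ≠ 0 → ‖x‖⁻¹ • x ∈ P ∩ Metric.sphere 0 1 := fun x hx hx0 =>
    ⟨hP.smul_mem (by positivity) hx, by simp [norm_smul, norm_ne_zero_iff.2 hx0]⟩
  obtain ⟨m, hm, hmS⟩ := hS.exists_forall_le' (f := φ) φ.continuous.continuousOn (a := 0) (by
    rintro x ⟨hx, hx1⟩
    exact hφ0 x hx (by rintro rfl; simp at hx1))
  set B := ‖T‖ + ε * ‖φ‖ * ‖f₀‖ with hB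
  have hTε : ∀ x ∈ P, T x + (ε * φ x) • f₀ ∈ P := fun x hx =>
    hP.add_mem (hT x hx) (hP.smul_mem (mul_nonneg hε.le (hφ x hx)) hf₀)
  have hA : IsCompact ((Set.Icc 0 (‖φ‖ * B / m) ×ˢ (P ∩ Metric.sphere 0 1)) ∩
      {p : ℝ × E | T p.2 + (ε * φ p.2) • f₀ - p.1 • p.2 ∈ P}) :=
    (isCompact_Icc.prod hS).inter_right (hP.isClosed.preimage (by fun_prop))
  have hr_le : ∀ r : ℝ, ∀ v ∈ P ∩ Metric.sphere 0 1, T v + (ε * φ v) • f₀ - r • v ∈ P →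
      r ≤ ‖φ‖ * B / m := by
    rintro r v hv hrv
    have hv1 : ‖v‖ = 1 := by simpa using hv.2
    have h1 := hφ _ hrv
    rw [map_sub, map_smul, smul_eq_mul] at h1
    have h2 : φ (T v + (ε * φ v) • f₀) ≤ ‖φ‖ * B := by
      refine (le_abs_self _).trans ((φ.le_opNorm _).trans ?_)
      gcongr
      refine (norm_add_le _ _).trans (add_le_add ?_ ?_)
      · simpa [hv1] using T.le_opNorm v
      · rw [norm_smul, norm_mul, Real.norm_of_nonneg hε.le]
        gcongr
        simpa [hv1] using φ.le_opNorm v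
    have h3 := hmS v hv
    rw [le_div_iff₀ hm]
    rcases le_or_gt r 0 with h0 | h0
    · have : r * m ≤ 0 := mul_nonpos_of_nonpos_of_nonneg h0 hm.le
      have : 0 ≤ ‖φ‖ * B := by positivity
      linarith
    · have : r * m ≤ r * φ v := by gcongr
      linarith
  obtain ⟨⟨r, v⟩, ⟨⟨hr, hv⟩, hrv⟩, hmax⟩ := hA.exists_isMaxOn
    ⟨(0, ‖x₁‖⁻¹ • x₁), ⟨⟨le_rfl, hr_le 0 _ (normalize x₁ hx₁ hx₁0) (by
      simpa using hTε _ (normalize x₁ hx₁ hx₁0).1)⟩, normalize x₁ hx₁ hx₁0⟩, by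
      simpa using hTε _ (normalize x₁ hx₁ hx₁0).1⟩ continuous_fst.continuousOn
  refine ⟨r, v, hv.1, by simpa using hv.2, ?_⟩
  by_contra hne
  simp only [Set.mem_ofPred_eq] at hrv hr hv
  set u := T v + (ε * φ v) • f₀ with hu
  set w := u - r • v with hw
  have hw0 : w ≠ 0 := sub_ne_zero.2 hne
  have huP : u ∈ P := hTε v hv.1
  have hu0 : u ≠ 0 := fun h0 => by
    refine hw0 (hsal w hrv ?_)
    rw [hw, h0, zero_sub, neg_neg]
    exact hP.smul_mem hr.1 hv.1
  have hun : 0 < ‖u‖ := norm_pos_iff.2 hu0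
  set η := ε * φ w * (δ / ‖u‖) with hη
  have hηpos : 0 < η := mul_pos (mul_pos hε (hφ0 w hrv hw0)) (by positivity)
  have h1 : T u + (ε * φ u) • f₀ - (r + η) • u ∈ P := by
    have h2 := hP.smul_sub_mem_of_relInterior hδ hrel (Submodule.subset_span huP)
    have h3 := hP.add_mem (hT w hrv) (hP.smul_mem hηpos.le h2)
    convert h3 using 1
    have e1 : T w = T u - r • T v := by rw [hw, map_sub, map_smul]
    have e2 : φ w = φ u - r * φ v := by rw [hw, map_sub, map_smul, smul_eq_mul]
    have e3 : η * (‖u‖ / δ) = ε * (φ u - r * φ v) := by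
      rw [← e2, hη]
      field_simp
    rw [e1, smul_sub, smul_smul, e3, add_smul]
    have e4 : r • u = r • T v + (r * (ε * φ v)) • f₀ := by
      rw [hu, smul_add, smul_smul]
    rw [e4]
    module
  have h2 := hP.smul_mem (t := ‖u‖⁻¹) (by positivity) h1
  have h3 : T (‖u‖⁻¹ • u) + (ε * φ (‖u‖⁻¹ • u)) • f₀ - (r + η) • (‖u‖⁻¹ • u) ∈ P := by
    convert h2 using 1
    rw [map_smul, map_smul, smul_eq_mul]
    module
  have h4 := hmax (show (r + η, ‖u‖⁻¹ • u) ∈ _ from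
    ⟨⟨⟨by linarith [hr.1], hr_le _ _ (normalize u huP hu0) h3⟩, normalize u huP hu0⟩, h3⟩)
  simp only [Set.mem_ofPred_eq] at h4
  linarith

/-- The Perron–Frobenius theorem: an operator preserving a salient closed cone has an
eigenvector in it. -/
theorem IsClosedCone.exists_eigenvector {P : Set E} (hP : IsClosedCone P)
    (hsal : ∀ x ∈ P, -x ∈ P → x = 0) (hP0 : ∃ x ∈ P, x ≠ 0) (T : E →L[ℝ] E)
    (hT : ∀ x ∈ P, T x ∈ P) : ∃ r : ℝ, ∃ v ∈ P, v ≠ 0 ∧ T v = r • v := by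
  have : ProperSpace E := FiniteDimensional.proper ℝ E
  have hS : IsCompact (P ∩ Metric.sphere 0 1) := (isCompact_sphere 0 1).inter_left hP.isClosed
  obtain ⟨φ, hφ, hφ0⟩ := hP.exists_strictly_positive hsal
  obtain ⟨f₀, hf₀, δ, hδ, hrel⟩ := hP.exists_relInterior
  set B := ‖T‖ + ‖φ‖ * ‖f₀‖ with hB
  have hA : IsCompact ((Set.Icc (0 : ℝ) 1 ×ˢ (Set.Icc (-B) B ×ˢ (P ∩ Metric.sphere 0 1))) ∩
      {p : ℝ × ℝ × E | T p.2.2 + (p.1 * φ p.2.2) • f₀ = p.2.1 • p.2.2}) :=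
    (isCompact_Icc.prod (isCompact_Icc.prod hS)).inter_right
      (isClosed_eq (by fun_prop) (by fun_prop))
  have hcl := (hA.image continuous_fst).isClosed
  have h0 : (0 : ℝ) ∈ closure (Set.Ioc (0 : ℝ) 1) := by
    rw [closure_Ioc zero_ne_one]
    simp
  obtain ⟨⟨ε, r, v⟩, ⟨⟨-, -, hv⟩, hrv⟩, rfl⟩ := hcl.closure_subset_iff.2 (fun ε hε => by
    obtain ⟨r, v, hv, hv1, hrv⟩ :=
      hP.exists_perturbed_eigenvector hsal hP0 T hT hφ hφ0 hf₀ hδ hrel hε.1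
    refine ⟨(ε, r, v), ⟨⟨⟨hε.1.le, hε.2⟩, abs_le.1 ?_, hv, by simpa using hv1⟩, hrv⟩, rfl⟩
    have h1 : |r| = ‖T v + (ε * φ v) • f₀‖ := by
      rw [hrv, norm_smul, hv1, mul_one, Real.norm_eq_abs]
    rw [h1]
    refine (norm_add_le _ _).trans (add_le_add ?_ ?_)
    · simpa [hv1] using T.le_opNorm v
    · rw [norm_smul, norm_mul, Real.norm_of_nonneg hε.1.le]
      gcongr
      have h2 := φ.le_opNorm v
      rw [hv1, mul_one] at h2
      nlinarith [hε.2, norm_nonneg (φ v)]) h0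
  refine ⟨r, v, hv.1, ?_, ?_⟩
  · rintro rfl
    have := hv.2
    simp at this
  · simpa using hrv

end PerronFrobenius

section WeightSpaces

variable {E : Type*} [NormedAddCommGroup E] [NormedSpace ℝ E] {G : Type*} [Group G]

/-- The vectors on which a subgroup acts through the character `χ`. -/
noncomputable def MonoidHom.weightSpace (ρ : G →* (E →L[ℝ] E)) (N : Subgroup G) (χ : N → ℝ) :
    Submodule ℝ E :=
  ⨅ n : N, Module.End.eigenspace (ρ n : E →ₗ[ℝ] E) (χ n)

theorem MonoidHom.mem_weightSpace (ρ : G →* (E →L[ℝ] E)) {N : Subgroup G} {χ : N → ℝ} {x : E} :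
    x ∈ ρ.weightSpace N χ ↔ ∀ n : N, ρ n x = χ n • x := by
  simp [MonoidHom.weightSpace, Submodule.mem_iInf]

theorem MonoidHom.finite_weightSpace_ne_bot [FiniteDimensional ℝ E] (ρ : G →* (E →L[ℝ] E))
    {N : Subgroup G} (hN : ∀ a b : N, a * b = b * a) :
    {χ : N → ℝ | ρ.weightSpace N χ ≠ ⊥}.Finite := by
  refine WellFoundedGT.finite_ne_bot_of_iSupIndep (iSupIndep.mono
    (Module.End.independent_iInf_maxGenEigenspace_of_forall_mapsTo
      (fun n : N => (ρ n : E →ₗ[ℝ] E)) fun i j φ => ?_) fun χ => iInf_mono fun n => ?_)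
  · refine Module.End.mapsTo_maxGenEigenspace_of_comm ?_ φ
    ext x
    change (ρ j * ρ i) x = (ρ i * ρ j) x
    rw [← map_mul, ← map_mul, ← Subgroup.coe_mul, hN, Subgroup.coe_mul]
  · exact Module.End.eigenspace_le_maxGenEigenspace

/-- An abelian normal subgroup of a strongly irreducible group which has a weight acts by
homotheties. -/
theorem MonoidHom.weightSpace_eq_top [FiniteDimensional ℝ E] (ρ : G →* (E →L[ℝ] E))
    (hirr : ∀ Δ : Subgroup G, Δ.FiniteIndex → ∀ W : Submodule ℝ E,
      (∀ g ∈ Δ, ∀ x ∈ W, ρ g x ∈ W) → W = ⊥ ∨ W = ⊤)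
    {N : Subgroup G} [N.Normal] (hN : ∀ a b : N, a * b = b * a) (χ : N → ℝ)
    (hχ : ρ.weightSpace N χ ≠ ⊥) : ρ.weightSpace N χ = ⊤ := by
  let : MulAction G (N → ℝ) :=
    { smul g ψ n := ψ (MulAut.conjNormal g⁻¹ n)
      one_smul ψ := funext fun n => congrArg ψ (by simp)
      mul_smul a b ψ := funext fun n => congrArg ψ (by simp) }
  have hsmul : ∀ (g : G) (ψ : N → ℝ) (n : N), (g • ψ) n = ψ (MulAut.conjNormal g⁻¹ n) :=
    fun _ _ _ => rfl
  have hmap : ∀ (g : G) (ψ : N → ℝ), ∀ x ∈ ρ.weightSpace N ψ, ρ g x ∈ ρ.weightSpace N (g • ψ) := by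
    intro g ψ x hx
    rw [MonoidHom.mem_weightSpace] at hx ⊢
    intro n
    rw [hsmul, ← map_smul, ← hx, ← mul_apply_eq_comp, ← mul_apply_eq_comp, ← map_mul, ← map_mul]
    simp [mul_assoc]
  have horb : (MulAction.orbit G χ).Finite := by
    refine (ρ.finite_weightSpace_ne_bot hN).subset ?_
    rintro _ ⟨g, rfl⟩
    obtain ⟨x, hx, hx0⟩ := Submodule.exists_mem_ne_zero_of_ne_bot hχ
    refine (Submodule.ne_bot_iff _).2 ⟨ρ g x, hmap g χ x hx, fun h0 => hx0 ?_⟩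
    rw [← ρ.clm_inv_apply g x, h0, map_zero]
  have hfin : (MulAction.stabilizer G χ).FiniteIndex := by
    refine ⟨?_⟩
    rw [MulAction.index_stabilizer]
    exact ((Set.ncard_pos horb).2 (MulAction.nonempty_orbit χ)).ne'
  refine (hirr _ hfin _ fun g hg x hx => ?_).resolve_left hχ
  have := hmap g χ x hx
  rwa [MulAction.mem_stabilizer_iff.1 hg] at this

end WeightSpaces

namespace IsCocompactConeAction

variable {E : Type*} [NormedAddCommGroup E] [NormedSpace ℝ E] [FiniteDimensional ℝ E]
  {G : Type*} [Group G] {ρ : G →* (E →L[ℝ] E)} {C K : Set E}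

theorem exists_pos_eigenvector (h : IsCocompactConeAction ρ C K) (W : Submodule ℝ E)
    (hW0 : ∃ x ∈ W, x ∈ closure C ∧ x ≠ 0) (g : G) (hg : ∀ x ∈ W, ρ g x ∈ W) :
    ∃ r : ℝ, 0 < r ∧ ∃ v ∈ W, v ∈ closure C ∧ v ≠ 0 ∧ ρ g v = r • v := by
  obtain ⟨x, hxW, hxC, hx0⟩ := hW0
  obtain ⟨r, v, hv, hv0, hr⟩ := (W.isClosedCone.inter h.isClosedCone).exists_eigenvector
    (fun x hx hx' => h.salient x hx.2 hx'.2) ⟨x, ⟨hxW, hxC⟩, hx0⟩ (ρ g)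
    fun x hx => ⟨hg x hx.1, h.map_mem_closure g hx.2⟩
  have hne : ρ g v ≠ 0 := fun h0 => hv0 (by rw [← ρ.clm_inv_apply g v, h0, map_zero])
  refine ⟨r, ?_, v, hv.1, hv.2, hv0, hr⟩
  by_contra hle
  refine hne (h.salient _ (h.map_mem_closure g hv.2) ?_)
  rw [hr, ← neg_smul]
  exact h.isClosedCone.smul_mem (by linarith) hv.2

/-- A strongly irreducible group dividing a cone has trivial virtual center. -/
theorem eq_one_of_finiteIndex_centralizer (h : IsCocompactConeAction ρ C K)
    (hscal : ∀ g, ∀ r : ℝ, 0 < r → (∀ x, ρ g x = r • x) → g = 1)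
    (hirr : ∀ Δ : Subgroup G, Δ.FiniteIndex → ∀ W : Submodule ℝ E,
      (∀ g ∈ Δ, ∀ x ∈ W, ρ g x ∈ W) → W = ⊥ ∨ W = ⊤)
    (g : G) (hg : (Subgroup.centralizer {g}).FiniteIndex) : g = 1 := by
  obtain ⟨x, hx⟩ := h.nonempty
  obtain ⟨r, hr, v, -, -, hv0, hv⟩ := h.exists_pos_eigenvector ⊤
    ⟨x, trivial, subset_closure hx, fun h0 => h.zero_notMem (h0 ▸ hx)⟩ g fun _ _ => trivial
  have htop : Module.End.eigenspace (ρ g : E →ₗ[ℝ] E) r = ⊤ := by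
    refine (hirr _ hg _ fun c hc x hx => ?_).resolve_left
      ((Submodule.ne_bot_iff _).2 ⟨v, Module.End.mem_eigenspace_iff.2 hv, hv0⟩)
    rw [Module.End.mem_eigenspace_iff] at hx ⊢
    change ρ g x = r • x at hx
    change ρ g (ρ c x) = r • ρ c x
    rw [← map_smul, ← hx, ← mul_apply_eq_comp, ← mul_apply_eq_comp, ← map_mul, ← map_mul,
      Subgroup.mem_centralizer_singleton_iff.1 hc]
  refine hscal g r hr fun x => Module.End.mem_eigenspace_iff.1
    (?_ : x ∈ Module.End.eigenspace (ρ g : E →ₗ[ℝ] E) r)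
  rw [htop]
  trivial

/-- A strongly irreducible group dividing a cone has no nontrivial abelian normal subgroup. -/
theorem eq_bot_of_abelian_normal (h : IsCocompactConeAction ρ C K)
    (hscal : ∀ g, ∀ r : ℝ, 0 < r → (∀ x, ρ g x = r • x) → g = 1)
    (hirr : ∀ Δ : Subgroup G, Δ.FiniteIndex → ∀ W : Submodule ℝ E,
      (∀ g ∈ Δ, ∀ x ∈ W, ρ g x ∈ W) → W = ⊥ ∨ W = ⊤)
    (N : Subgroup G) [N.Normal] (hN : ∀ a b : N, a * b = b * a) : N = ⊥ := by
  obtain ⟨x, hx⟩ := h.nonempty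
  obtain ⟨W, ⟨hW, hWC⟩, hmin⟩ := wellFounded_lt.has_min
    {W : Submodule ℝ E | (∀ n ∈ N, ∀ x ∈ W, ρ n x ∈ W) ∧ ∃ x ∈ W, x ∈ closure C ∧ x ≠ 0}
    ⟨⊤, fun _ _ _ _ => trivial, x, trivial, subset_closure hx, fun h0 => h.zero_notMem (h0 ▸ hx)⟩
  have hscalW : ∀ n : N, ∃ r : ℝ, 0 < r ∧ ∀ x ∈ W, ρ n x = r • x := by
    intro n
    obtain ⟨r, hr, v, hvW, hvC, hv0, hv⟩ := h.exists_pos_eigenvector W hWC n (hW n n.2)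
    refine ⟨r, hr, fun x hx => ?_⟩
    have hmem : W ⊓ Module.End.eigenspace (ρ n : E →ₗ[ℝ] E) r ∈
        {W : Submodule ℝ E | (∀ n ∈ N, ∀ x ∈ W, ρ n x ∈ W) ∧ ∃ x ∈ W, x ∈ closure C ∧ x ≠ 0} := by
      refine ⟨fun m hm x hx => ⟨hW m hm x hx.1, ?_⟩,
        v, ⟨hvW, Module.End.mem_eigenspace_iff.2 hv⟩, hvC, hv0⟩
      have hx2 : ρ n x = r • x := Module.End.mem_eigenspace_iff.1 hx.2
      refine Module.End.mem_eigenspace_iff.2 (?_ : ρ n (ρ m x) = r • ρ m x)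
      have hnm : (n : G) * m = m * n := congrArg Subtype.val (hN n ⟨m, hm⟩)
      rw [← map_smul, ← hx2, ← mul_apply_eq_comp, ← mul_apply_eq_comp, ← map_mul, ← map_mul, hnm]
    have hle : W ≤ W ⊓ Module.End.eigenspace (ρ n : E →ₗ[ℝ] E) r := by
      by_contra hne
      exact hmin _ hmem (lt_of_le_not_ge inf_le_left hne)
    exact Module.End.mem_eigenspace_iff.1 (hle hx).2
  choose χ hχ0 hχ using hscalW
  obtain ⟨y, hyW, -, hy0⟩ := hWC
  have htop := ρ.weightSpace_eq_top hirr hN χ ((Submodule.ne_bot_iff _).2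
    ⟨y, ρ.mem_weightSpace.2 fun n => hχ n y hyW, hy0⟩)
  refine (Subgroup.eq_bot_iff_forall _).2 fun n hn => hscal n _ (hχ0 ⟨n, hn⟩) fun x =>
    ρ.mem_weightSpace.1 (?_ : x ∈ ρ.weightSpace N χ) ⟨n, hn⟩
  rw [htop]
  trivial

/-- A strongly irreducible group dividing a cone has no nontrivial nilpotent normal subgroup. -/
theorem eq_bot_of_nilpotent_normal (h : IsCocompactConeAction ρ C K)
    (hscal : ∀ g, ∀ r : ℝ, 0 < r → (∀ x, ρ g x = r • x) → g = 1)
    (hirr : ∀ Δ : Subgroup G, Δ.FiniteIndex → ∀ W : Submodule ℝ E,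
      (∀ g ∈ Δ, ∀ x ∈ W, ρ g x ∈ W) → W = ⊥ ∨ W = ⊤)
    (N : Subgroup G) [N.Normal] [Group.IsNilpotent N] : N = ⊥ := by
  by_contra hne
  have : Nontrivial N := N.nontrivial_iff_ne_bot.2 hne
  refine Group.IsNilpotent.center_ne_bot N ?_
  have hcenter := h.eq_bot_of_abelian_normal hscal hirr ((Subgroup.center N).map N.subtype) ?_
  · exact (Subgroup.map_eq_bot_iff_of_injective _ N.subtype_injective).1 hcenter
  · rintro ⟨_, a, ha, rfl⟩ ⟨_, b, -, rfl⟩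
    exact Subtype.ext (congrArg N.subtype (Subgroup.mem_center_iff.1 ha b).symm)

end IsCocompactConeAction

namespace IsCocompactConeAction

variable {E : Type*} [NormedAddCommGroup E] [NormedSpace ℝ E]
  {G : Type*} [Group G] {ρ : G →* (E →L[ℝ] E)} {C K : Set E}

theorem restrict_finiteIndex (h : IsCocompactConeAction ρ C K) (Δ : Subgroup G) [Δ.FiniteIndex] :
    IsCocompactConeAction (ρ.comp Δ.subtype) C (⋃ q : G ⧸ Δ, ρ q.out⁻¹ '' K) where
  isOpen := h.isOpen
  nonempty := h.nonempty
  add_mem := h.add_mem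
  smul_mem := h.smul_mem
  zero_notMem := h.zero_notMem
  salient := h.salient
  map_mem g _ hx := h.map_mem g hx
  isCompact := isCompact_iUnion fun _ => h.isCompact.image (ρ _).continuous
  subset := Set.iUnion_subset fun _ => Set.image_subset_iff.2 fun _ hx => h.map_mem _ (h.subset hx)
  cover x hx := by
    obtain ⟨g, τ, hτ, k, hk, rfl⟩ := h.cover x hx
    obtain ⟨δ, hδ⟩ := QuotientGroup.mk_out_eq_mul Δ g⁻¹
    refine ⟨δ, τ, hτ, _, Set.mem_iUnion.2 ⟨(g⁻¹ : G), k, hk, rfl⟩, ?_⟩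
    rw [hδ, MonoidHom.comp_apply, ← mul_apply_eq_comp, ← map_mul]
    simp

theorem exists_normal_infinite_center [FiniteDimensional ℝ E] (h : IsCocompactConeAction ρ C K)
    (hρ : Function.Injective ρ)
    (hfin : ∀ M : ℝ, {g | ‖ρ g‖ ≤ M ∧ ‖ρ g⁻¹‖ ≤ M}.Finite)
    (hirr : ¬ ∀ Δ : Subgroup G, Δ.FiniteIndex → ∀ W : Submodule ℝ E,
      (∀ g ∈ Δ, ∀ x ∈ W, ρ g x ∈ W) → W = ⊥ ∨ W = ⊤) :
    ∃ N : Subgroup G, N.Normal ∧ N.FiniteIndex ∧ Infinite (Subgroup.center N) := by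
  push Not at hirr
  obtain ⟨Δ, hΔ, W, hW, hW0, hW1⟩ := hirr
  refine ⟨Δ.normalCore, inferInstance, inferInstance, ?_⟩
  refine (h.restrict_finiteIndex Δ.normalCore).infinite_center
    (hρ.comp Subtype.val_injective) (fun M => ?_) W
    (fun g => hW g (Δ.normalCore_le g.2)) hW0 hW1
  exact (hfin M).preimage Subtype.val_injective.injOn

/-- Benoist's characterization of strong irreducibility, for a group dividing a cone. -/
theorem tfae_stronglyIrreducible [FiniteDimensional ℝ E] (h : IsCocompactConeAction ρ C K)
    (hρ : Function.Injective ρ) (hfin : ∀ M : ℝ, {g | ‖ρ g‖ ≤ M ∧ ‖ρ g⁻¹‖ ≤ M}.Finite)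
    (hscal : ∀ g, ∀ r : ℝ, 0 < r → (∀ x, ρ g x = r • x) → g = 1) :
    List.TFAE
      [ ∀ g : G, (Subgroup.centralizer {g}).FiniteIndex → g = 1,
        ∀ Δ : Subgroup G, Δ.FiniteIndex → Finite (Subgroup.center Δ),
        ∀ Δ : Subgroup G, Δ.FiniteIndex → ∀ W : Submodule ℝ E,
          (∀ g ∈ Δ, ∀ x ∈ W, ρ g x ∈ W) → W = ⊥ ∨ W = ⊤,
        ∀ N : Subgroup G, N.Normal → Group.IsNilpotent N → Finite N,
        ∀ N : Subgroup G, N.Normal → (∀ a b : N, a * b = b * a) → Finite N ] := by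
  have hcent : ∀ (Δ : Subgroup G) [Δ.FiniteIndex] (z : Δ), z ∈ Subgroup.center Δ →
      (Subgroup.centralizer {(z : G)}).FiniteIndex := fun Δ _ z hz =>
    Subgroup.finiteIndex_of_le (H := Δ) fun g hg => Subgroup.mem_centralizer_singleton_iff.2
      (congrArg Subtype.val (Subgroup.mem_center_iff.1 hz ⟨g, hg⟩))
  tfae_have 1 → 2 := by
    intro h1 Δ hΔ
    have : Subsingleton (Subgroup.center Δ) := subsingleton_of_forall_eq 1 fun z =>
      Subtype.ext (Subtype.ext (h1 _ (hcent Δ z z.2)))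
    infer_instance
  tfae_have 2 → 3 := by
    intro h2
    by_contra h3
    obtain ⟨N, -, hNf, hN⟩ := h.exists_normal_infinite_center hρ hfin h3
    exact hN.not_finite (h2 N hNf)
  tfae_have 3 → 1 := fun h3 => h.eq_one_of_finiteIndex_centralizer hscal h3
  tfae_have 3 → 4 := by
    intro h3 N _ _
    rw [h.eq_bot_of_nilpotent_normal hscal h3 N]
    infer_instance
  tfae_have 4 → 5 := by
    intro h4 N hN hab
    let _ : CommGroup N := { mul_comm := hab }
    exact h4 N hN inferInstance
  tfae_have 5 → 3 := by
    intro h5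
    by_contra h3
    obtain ⟨N, hNn, -, hN⟩ := h.exists_normal_infinite_center hρ hfin h3
    have hA := h5 ((Subgroup.center N).map N.subtype) inferInstance (by
      rintro ⟨_, a, ha, rfl⟩ ⟨_, b, -, rfl⟩
      exact Subtype.ext (congrArg N.subtype (Subgroup.mem_center_iff.1 ha b).symm))
    exact hN.not_finite (Finite.of_equiv _
      ((Subgroup.center N).equivMapOfInjective _ N.subtype_injective).symm.toEquiv)
  tfae_finish

end IsCocompactConeAction

section ProperCones

variable {d : ℕ} {C : Set (Vec d)}

theorem IsProperCone.add_mem_of_mem_closure (hC : IsProperCone C) {x y : Vec d} (hx : x ∈ C)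
    (hy : y ∈ closure C) : x + y ∈ C := by
  obtain ⟨-, hopen, hconv, hsmul, -⟩ := hC
  have h1 := hconv.openSegment_interior_closure_subset_interior (hopen.interior_eq.symm ▸ hx) hy
    (⟨1 / 2, 1 / 2, by norm_num, by norm_num, by norm_num, rfl⟩ :
      (1 / 2 : ℝ) • x + (1 / 2 : ℝ) • y ∈ openSegment ℝ x y)
  have h2 := hsmul _ (interior_subset h1) 2 two_pos
  rwa [← smul_add, smul_smul, mul_one_div_cancel two_ne_zero, one_smul] at h2

theorem IsProperCone.zero_notMem (hC : IsProperCone C) : (0 : Vec d) ∉ C := by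
  obtain ⟨-, hopen, -, hsmul, hline⟩ := hC
  intro h0
  obtain ⟨v, hv⟩ := exists_ne (0 : Vec d)
  refine hline ⟨0, v, hv, fun t => ?_⟩
  have h1 : Filter.Tendsto (fun s : ℝ => s • (0 + t • v)) (nhdsWithin 0 (Set.Ioi 0)) (nhds 0) := by
    have : Filter.Tendsto (fun s : ℝ => s • (0 + t • v)) (nhds 0) (nhds ((0 : ℝ) • (0 + t • v))) :=
      (continuous_id.smul continuous_const).tendsto 0
    rw [zero_smul] at this
    exact this.mono_left nhdsWithin_le_nhds
  obtain ⟨s, hs, hs0⟩ := ((h1.eventually_mem (hopen.mem_nhds h0)).and self_mem_nhdsWithin).exists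
  have h2 := hsmul _ hs s⁻¹ (inv_pos.2 hs0)
  rwa [smul_smul, inv_mul_cancel₀ (ne_of_gt hs0), one_smul] at h2

theorem IsProperCone.salient (hC : IsProperCone C) (x : Vec d) (hx : x ∈ closure C)
    (hx' : -x ∈ closure C) : x = 0 := by
  by_contra hx0
  obtain ⟨y, hy⟩ := hC.1
  refine hC.2.2.2.2 ⟨y, x, hx0, fun t => ?_⟩
  have hsmul : ∀ s : ℝ, 0 < s → ∀ z ∈ closure C, s • z ∈ closure C := fun s hs z hz =>
    map_mem_closure (continuous_const_smul s) hz fun _ ha => hC.2.2.2.1 _ ha s hs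
  rcases lt_trichotomy t 0 with ht | rfl | ht
  · have := hC.add_mem_of_mem_closure hy (hsmul (-t) (neg_pos.2 ht) _ hx')
    rwa [smul_neg, neg_smul, neg_neg] at this
  · rwa [zero_smul, add_zero]
  · exact hC.add_mem_of_mem_closure hy (hsmul t ht _ hx)

theorem isOpen_projOfCone (hC : IsOpen C) : IsOpen (projOfCone C) := by
  have h1 : IsOpen {x : {v : Vec d // v ≠ 0} | ∃ t : ℝ, t ≠ 0 ∧ t • (x : Vec d) ∈ C} := by
    have : {x : {v : Vec d // v ≠ 0} | ∃ t : ℝ, t ≠ 0 ∧ t • (x : Vec d) ∈ C} =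
        ⋃ t : {t : ℝ // t ≠ 0}, (fun x : {v : Vec d // v ≠ 0} => (t : ℝ) • (x : Vec d)) ⁻¹' C := by
      ext x
      simp
    rw [this]
    exact isOpen_iUnion fun t => hC.preimage (continuous_subtype_val.const_smul (t : ℝ))
  refine isOpen_coinduced.2 ?_
  convert h1 using 1
  ext x
  constructor
  · rintro ⟨v, hv, hvC, hxv⟩
    obtain ⟨a, ha⟩ := (Projectivization.mk_eq_mk_iff' ℝ v x hv x.2).1 hxv.symm
    exact ⟨a, fun h0 => hv (by rw [← ha, h0, zero_smul]), ha ▸ hvC⟩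
  · rintro ⟨t, ht, htx⟩
    exact ⟨t • (x : Vec d), smul_ne_zero ht x.2, htx,
      (Projectivization.mk_eq_mk_iff' ℝ _ _ x.2 (smul_ne_zero ht x.2)).2
        ⟨t⁻¹, inv_smul_smul₀ ht _⟩⟩

/-- A compact subset of a properly convex domain lifts to a compact subset of the cone. -/
theorem IsCompact.exists_lift_projOfCone {K : Set (RP d)} (hK : IsCompact K) (hC : IsOpen C)
    (hKC : K ⊆ projOfCone C) : ∃ L, IsCompact L ∧ L ⊆ C ∧ K ⊆ projOfCone L := by
  have h1 : ∀ P : RP d, ∃ L : Set (Vec d), IsCompact L ∧ L ⊆ C ∧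
      (P ∈ K → projOfCone L ∈ nhds P) := by
    intro P
    by_cases hP : P ∈ K
    · obtain ⟨v, hv, hvC, rfl⟩ := hKC hP
      obtain ⟨L, hL, hvL, hLC⟩ := exists_compact_subset hC hvC
      refine ⟨L, hL, hLC, fun _ => Filter.mem_of_superset
        ((isOpen_projOfCone isOpen_interior).mem_nhds ⟨v, hv, hvL, rfl⟩) ?_⟩
      rintro _ ⟨w, hw, hwL, rfl⟩
      exact ⟨w, hw, interior_subset hwL, rfl⟩
    · exact ⟨∅, isCompact_empty, Set.empty_subset _, fun h => absurd h hP⟩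
  choose L hL hLC hLn using h1
  obtain ⟨t, -, ht⟩ := hK.elim_nhds_subcover (fun P => projOfCone (L P)) hLn
  refine ⟨⋃ P ∈ t, L P, t.finite_toSet.isCompact_biUnion fun P _ => hL P,
    Set.iUnion₂_subset fun P _ => hLC P, fun Q hQ => ?_⟩
  obtain ⟨P, hP, v, hv, hvL, rfl⟩ := Set.mem_iUnion₂.1 (ht hQ)
  exact ⟨v, hv, Set.mem_biUnion hP hvL, rfl⟩

end ProperCones

section LinearGroups

theorem Matrix.isCompact_abs_apply_le (n : Type*) (M : ℝ) :
    IsCompact {A : Matrix n n ℝ | ∀ i j, |A i j| ≤ M} := by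
  have h1 : IsCompact (X := Matrix n n ℝ)
      (Set.univ.pi fun _ : n => Set.univ.pi fun _ : n => Set.Icc (-M) M) :=
    isCompact_univ_pi fun _ => isCompact_univ_pi fun _ => isCompact_Icc
  have h2 : {A : Matrix n n ℝ | ∀ i j, |A i j| ≤ M} =
      Set.univ.pi fun _ : n => Set.univ.pi fun _ : n => Set.Icc (-M) M := by
    ext A
    exact ⟨fun h i _ j _ => abs_le.1 (h i j), fun h i j => abs_le.2 (h i trivial j trivial)⟩
  rw [h2]
  exact h1

variable {n : Type*} [Fintype n] [DecidableEq n]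

/-- The standard representation of the general linear group, by continuous operators. -/
noncomputable def Matrix.GeneralLinearGroup.toCLMHom (n : Type*) [Fintype n] [DecidableEq n] :
    GL n ℝ →* ((n → ℝ) →L[ℝ] (n → ℝ)) where
  toFun g := LinearMap.toContinuousLinearMap (Matrix.mulVecLin (g : Matrix n n ℝ))
  map_one' := by
    ext1 x
    simp
  map_mul' a b := by
    ext1 x
    change ((a * b : GL n ℝ) : Matrix n n ℝ) *ᵥ x = (a : Matrix n n ℝ) *ᵥ ((b : Matrix n n ℝ) *ᵥ x)
    rw [Matrix.mulVec_mulVec, Units.val_mul]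

theorem Matrix.GeneralLinearGroup.toCLMHom_apply (g : GL n ℝ) (x : n → ℝ) :
    toCLMHom n g x = (g : Matrix n n ℝ) *ᵥ x := rfl

theorem Matrix.GeneralLinearGroup.toCLMHom_injective :
    Function.Injective (toCLMHom n) := fun _ _ h =>
  Units.ext (Matrix.ext_of_mulVec_single fun i => congrArg (· (Pi.single i 1)) h)

theorem Matrix.GeneralLinearGroup.abs_apply_le_norm_toCLMHom (g : GL n ℝ) (i j : n) :
    |(g : Matrix n n ℝ) i j| ≤ ‖toCLMHom n g‖ := by
  have h1 := (norm_le_pi_norm (toCLMHom n g (Pi.single j 1)) i).trans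
    ((toCLMHom n g).le_opNorm _)
  rwa [toCLMHom_apply, Matrix.mulVec_single_one, Pi.norm_single, norm_one, mul_one] at h1

theorem Matrix.GeneralLinearGroup.isCompact_abs_apply_le (M : ℝ) :
    IsCompact {g : GL n ℝ | (∀ i j, |(g : Matrix n n ℝ) i j| ≤ M) ∧
      ∀ i j, |((g⁻¹ : GL n ℝ) : Matrix n n ℝ) i j| ≤ M} := by
  have h1 := (Matrix.isCompact_abs_apply_le n M).prod
    (MulOpposite.opHomeomorph.symm.isCompact_preimage.2 (Matrix.isCompact_abs_apply_le n M))
  exact Units.isClosedEmbedding_embedProduct.isCompact_preimage h1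

theorem Subgroup.finite_norm_toCLMHom_le (Γ : Subgroup (GL n ℝ)) [DiscreteTopology Γ] (M : ℝ) :
    {g : Γ | ‖GeneralLinearGroup.toCLMHom n g‖ ≤ M ∧
      ‖GeneralLinearGroup.toCLMHom n (g⁻¹ : Γ)‖ ≤ M}.Finite := by
  have h1 := (isCompact_iff_finite.1 ((Γ.isClosed_of_discrete).isClosedEmbedding_subtypeVal
    |>.isCompact_preimage (GeneralLinearGroup.isCompact_abs_apply_le (n := n) M)))
  exact h1.subset fun g hg =>
    ⟨fun i j => (GeneralLinearGroup.abs_apply_le_norm_toCLMHom _ i j).trans hg.1,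
      fun i j => (GeneralLinearGroup.abs_apply_le_norm_toCLMHom _ i j).trans hg.2⟩

end LinearGroups

section DividingGroups

open Matrix.GeneralLinearGroup

variable {d : ℕ} {C : Set (Vec d)} {Γ : Subgroup (GL (Fin (d + 1)) ℝ)}

theorem detPM1.eq_one_of_smul {g : GL (Fin (d + 1)) ℝ} (hg : detPM1 g) {r : ℝ} (hr : 0 < r)
    (h : ∀ x, toCLMHom (Fin (d + 1)) g x = r • x) : g = 1 := by
  have h1 : (g : Matrix (Fin (d + 1)) (Fin (d + 1)) ℝ) = r • 1 :=
    Matrix.ext_of_mulVec_single fun i => by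
      rw [Matrix.smul_mulVec, Matrix.one_mulVec]
      exact h _
  have h2 : r ^ (d + 1) = 1 := by
    have hpos := pow_pos hr (d + 1)
    rcases hg with hg | hg <;> rw [h1, Matrix.det_smul, Matrix.det_one, Fintype.card_fin,
      mul_one] at hg
    · exact hg
    · linarith
  rw [pow_eq_one_iff_of_nonneg hr.le d.succ_ne_zero] at h2
  exact Units.ext (by rw [h1, h2, one_smul, Units.val_one])

theorem CocompactOn.exists_isCocompactConeAction (hC : IsProperCone C)
    (hpres : ∀ γ ∈ Γ, ∀ x ∈ C, toCLMHom _ γ x ∈ C) (hco : CocompactOn Γ (projOfCone C)) :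
    ∃ L, IsCocompactConeAction ((toCLMHom (Fin (d + 1))).comp Γ.subtype) C L := by
  obtain ⟨K, hK, hKC, hcover⟩ := hco
  obtain ⟨L, hL, hLC, hKL⟩ := hK.exists_lift_projOfCone hC.2.1 hKC
  refine ⟨L, hC.2.1, hC.1, fun hx hy => hC.add_mem_of_mem_closure hx (subset_closure hy),
    fun ht hx => hC.2.2.2.1 _ hx _ ht, hC.zero_notMem, hC.salient,
    fun γ _ hx => hpres γ γ.2 _ hx, hL, hLC, fun x hx => ?_⟩
  have hx0 : x ≠ 0 := fun h0 => hC.zero_notMem (h0 ▸ hx)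
  have hxΩ : Projectivization.mk ℝ x hx0 ∈ projOfCone C := ⟨x, hx0, hx, rfl⟩
  rw [← hcover] at hxΩ
  obtain ⟨γ, hγ, P, hP, hPx⟩ := Set.mem_iUnion₂.1 hxΩ
  obtain ⟨k, hk0, hk, rfl⟩ := hKL hP
  have hγk := hpres γ hγ k (hLC hk)
  have hγk0 : toCLMHom _ γ k ≠ 0 := fun h0 => hC.zero_notMem (h0 ▸ hγk)
  obtain ⟨a, ha⟩ := (Projectivization.mk_eq_mk_iff' ℝ x (toCLMHom _ γ k) hx0 hγk0).1 hPx.symm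
  refine ⟨⟨γ, hγ⟩, a, ?_, k, hk, ha.symm⟩
  by_contra hle
  rcases (not_lt.1 hle).eq_or_lt with rfl | hneg
  · exact hx0 (by rw [← ha, zero_smul])
  · refine hC.zero_notMem ?_
    have := hC.add_mem_of_mem_closure hx
      (subset_closure (hC.2.2.2.1 _ hγk (-a) (neg_pos.2 hneg)))
    rw [← ha, neg_smul] at this
    rwa [add_neg_eq_zero.2 rfl] at this

theorem stronglyIrreducible_iff :
    StronglyIrreducible Γ ↔ ∀ Δ : Subgroup Γ, Δ.FiniteIndex → ∀ W : Submodule ℝ (Vec d),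
      (∀ g ∈ Δ, ∀ x ∈ W, (toCLMHom (Fin (d + 1))).comp Γ.subtype g x ∈ W) → W = ⊥ ∨ W = ⊤ := by
  constructor
  · intro h Δ hΔ W hW
    refine h (Δ.map Γ.subtype) (Subgroup.map_subtype_le Δ) ?_ W ?_
    · rwa [Subgroup.subgroupOf, Subgroup.comap_map_eq_self_of_injective Γ.subtype_injective]
    · rintro _ ⟨g, hg, rfl⟩
      exact hW g hg
  · intro h Δ hΔ hfin W hW
    exact h _ hfin W fun g hg => hW g hg

end DividingGroups

/-- Benoist's characterization: for a discrete subgroup `Γ ≤ SL^±_{d+1}(ℝ)` preserving a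
sharp convex open cone `C` and acting cocompactly on the properly convex domain
`Ω = P(C)`, the following are equivalent: trivial virtual center; all finite-index
subgroups have finite center; strong irreducibility; no infinite nilpotent normal
subgroup; no infinite abelian normal subgroup. -/
theorem benoist_virtual_center_tfae (d : ℕ) (hd : 1 ≤ d)
    (C : Set (Vec d)) (hC : IsProperCone C)
    (Ω : Set (RP d)) (hΩ : Ω = projOfCone C)
    (Γ : Subgroup (GL (Fin (d + 1)) ℝ))
    (hdet : ∀ γ ∈ Γ, detPM1 γ)
    (hdisc : DiscreteTopology Γ)
    (hpres : ∀ γ ∈ Γ,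
      (fun v => Matrix.mulVec ((γ : GL (Fin (d + 1)) ℝ) : Matrix (Fin (d + 1)) (Fin (d + 1)) ℝ) v) '' C = C)
    (hcocompact : CocompactOn Γ Ω) :
    List.TFAE
      [ -- (i) the virtual center of Γ is trivial
        ∀ g : Γ, (Subgroup.centralizer {g}).FiniteIndex → g = 1,
        -- (ii) every finite-index subgroup of Γ has finite center
        ∀ Δ : Subgroup Γ, Δ.FiniteIndex → Finite (Subgroup.center Δ),
        -- (iii) every finite-index subgroup of Γ acts irreducibly on ℝ^{d+1}
        StronglyIrreducible Γ,
        -- (iv) Γ contains no infinite nilpotent normal subgroup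
        ∀ N : Subgroup Γ, N.Normal → Group.IsNilpotent N → Finite N,
        -- (v) Γ contains no infinite abelian normal subgroup
        ∀ N : Subgroup Γ, N.Normal → (∀ a b : N, a * b = b * a) → Finite N ] := by
  subst hΩ
  have hpres' : ∀ γ ∈ Γ, ∀ x ∈ C, Matrix.GeneralLinearGroup.toCLMHom _ γ x ∈ C := fun γ hγ x hx =>
    (hpres γ hγ).subset ⟨x, hx, rfl⟩
  obtain ⟨L, hL⟩ := hcocompact.exists_isCocompactConeAction hC hpres'
  rw [stronglyIrreducible_iff]
  exact hL.tfae_stronglyIrreducible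
    (Matrix.GeneralLinearGroup.toCLMHom_injective.comp Subtype.val_injective)
    Γ.finite_norm_toCLMHom_le
    fun γ _ hr h => Subtype.ext ((hdet γ γ.2).eq_one_of_smul hr h)
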